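/- arXiv:1703.01126 — 4 statements merged into one kernel-verified Lean document; each statement's English description precedes it below -/
import Mathlib

section
/- Let n ≥ 2 and let c = (c_0, …, c_{2n-2}) ∈ ℝ^{2n-1} be such that the Hankel matrix H(c) is positive definite. Let t_1 < … < t_{n-1} be the unique roots of the canonical representation c_k = ∑_{j=1}^{n-1} σ_j·t_j^k (k = 0, …, 2n-3), c_{2n-2} = ∑_{j=1}^{n-1} σ_j·t_j^{2n-2} + λ with σ_j > 0 and λ > 0, and set t_0 = -∞, t_n = +∞. Fix k_0 ∈ {1, …, n} and x_{k_0} ∈ (t_{k_0-1}, t_{k_0}). Then there exist unique roots x_k ∈ (t_{k-1}, t_k) for k ≠ k_0 and unique weights ϱ_1, …, ϱ_n > 0 such that c_k = ∑_{j=1}^n ϱ_j·x_j^k for every k = 0, …, 2n-2. -/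
open Finset

/-- The `n × n` Hankel matrix `H(c)` associated with `c = (c_0, …, c_{2n-2})`,
with entries `H(c)_{ij} = c_{i+j}`. -/
def hankel (n : ℕ) (c : Fin (2 * n - 1) → ℝ) : Matrix (Fin n) (Fin n) ℝ :=
  Matrix.of fun i j =>
    c ⟨(i : ℕ) + (j : ℕ), by have hi := i.isLt; have hj := j.isLt; omega⟩

open Polynomial in
lemma natDegree_lt_iff_deg {n : ℕ} {p : ℝ[X]} (hn : 0 < n) :
    p.natDegree < n ↔ p.degree < n := by
  by_cases hp : p = 0
  · subst hp; simpa using hn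
  · exact natDegree_lt_iff_degree_lt hp

open Polynomial in
/-- The moment functional with nodes `t`, weights `σ` and mass `lam` at infinity. -/
noncomputable def momL (m : ℕ) (t σ : Fin m → ℝ) (lam : ℝ) : ℝ[X] →ₗ[ℝ] ℝ :=
  (∑ j, σ j • Polynomial.leval (t j)) + lam • Polynomial.lcoeff ℝ (2 * m)

open Polynomial in
lemma momL_apply (m : ℕ) (t σ : Fin m → ℝ) (lam : ℝ) (p : ℝ[X]) :
    momL m t σ lam p = ∑ j, σ j * p.eval (t j) + lam * p.coeff (2 * m) := by
  simp [momL, LinearMap.sum_apply, Polynomial.leval]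

open Polynomial in
lemma momL_ext (m : ℕ) (t σ : Fin m → ℝ) (lam : ℝ) (x ρ : Fin (m + 1) → ℝ)
    (h : ∀ k, k < 2 * m + 1 → momL m t σ lam (X ^ k) = ∑ j, ρ j * x j ^ k)
    (p : ℝ[X]) (hp : p.natDegree ≤ 2 * m) :
    momL m t σ lam p = ∑ j, ρ j * p.eval (x j) := by
  conv_lhs => rw [p.as_sum_range_C_mul_X_pow' (Nat.lt_succ_of_le hp)]
  rw [map_sum]
  have : ∀ j, p.eval (x j) = ∑ i ∈ range (2 * m + 1), p.coeff i * x j ^ i := fun j =>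
    eval_eq_sum_range' (Nat.lt_succ_of_le hp) _
  simp_rw [this, mul_sum]
  rw [sum_comm]
  refine sum_congr rfl fun i hi => ?_
  rw [← smul_eq_C_mul, map_smul, h i (mem_range.1 hi), smul_eq_mul, mul_sum]
  exact sum_congr rfl fun _ _ => by ring

open Polynomial in
/-- Orthogonality is a pointwise condition at the nodes. -/
lemma momL_mul (m : ℕ) (hm : 1 ≤ m) (t σ : Fin m → ℝ) (lam : ℝ) (ht : StrictMono t)
    (Q : ℝ[X]) (hQ : Q.Monic) (hQd : Q.natDegree = m + 1) (r : ℝ[X]) (hr : r.degree < m) :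
    momL m t σ lam (Q * r) = ∑ j, (σ j * Q.eval (t j) +
      lam / ∏ i ∈ univ.erase j, (t j - t i)) * r.eval (t j) := by
  have hc : (Q * r).coeff (2 * m) = r.coeff (m - 1) := by
    have h1 : 2 * m = (m + 1) + (m - 1) := by omega
    have h2 : r.natDegree ≤ m - 1 := by
      have := (natDegree_lt_iff_deg (n := m) (p := r) (by omega)).2 hr
      omega
    rw [h1, coeff_mul_add_eq_of_natDegree_le hQd.le h2]
    have : Q.coeff (m + 1) = 1 := by rw [← hQd]; exact hQ
    rw [this, one_mul]
  have h3 := Lagrange.coeff_eq_sum (s := univ) (v := t) (ht.injective.injOn) (P := r) (by simpa using hr)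
  rw [card_univ, Fintype.card_fin] at h3
  rw [momL_apply, hc, h3, mul_sum, ← sum_add_distrib]
  refine sum_congr rfl fun j _ => ?_
  rw [eval_mul]; ring

open Polynomial in
lemma prod_erase_sign (m : ℕ) (t : Fin m → ℝ) (ht : StrictMono t) (j : Fin m) :
    0 < (-1 : ℝ) ^ (m - 1 - (j : ℕ)) * ∏ i ∈ univ.erase j, (t j - t i) := by
  have h : (univ.erase j : Finset (Fin m)) = Finset.disjUnion (Finset.Iio j) (Finset.Ioi j)
      (by rw [Finset.disjoint_left]; intro a; simp; exact fun h => h.le) := by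
    ext a; simp
  rw [h, prod_disjUnion]
  have h2 : ∏ i ∈ Ioi j, (t j - t i) = (-1) ^ (m - 1 - (j : ℕ)) * ∏ i ∈ Ioi j, (t i - t j) := by
    rw [← Fin.card_Ioi, ← prod_const, ← prod_mul_distrib]
    exact prod_congr rfl fun _ _ => by ring
  rw [h2]
  have h3 : 0 < ∏ i ∈ Iio j, (t j - t i) := prod_pos fun i hi => sub_pos.2 (ht (mem_Iio.1 hi))
  have h4 : 0 < ∏ i ∈ Ioi j, (t i - t j) := prod_pos fun i hi => sub_pos.2 (ht (mem_Ioi.1 hi))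
  have h5 : ((-1 : ℝ) ^ (m - 1 - (j : ℕ))) * (-1 : ℝ) ^ (m - 1 - (j : ℕ)) = 1 := by
    rw [← mul_pow]; simp
  have := mul_pos h3 h4
  calc (0:ℝ) < _ := this
    _ = (((-1 : ℝ) ^ (m - 1 - (j : ℕ))) * (-1 : ℝ) ^ (m - 1 - (j : ℕ))) *
      ((∏ i ∈ Iio j, (t j - t i)) * ∏ i ∈ Ioi j, (t i - t j)) := by rw [h5, one_mul]
    _ = _ := by ring

open Polynomial Filter in
lemma far_right (Q : ℝ[X]) (hQ : Q.Monic) (hd : 0 < Q.natDegree) (b : ℝ) :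
    ∃ B, b < B ∧ 0 < Q.eval B := by
  have h := Q.tendsto_atTop_of_leadingCoeff_nonneg (natDegree_pos_iff_degree_pos.1 hd)
    (by rw [hQ.leadingCoeff]; norm_num)
  exact ((eventually_gt_atTop b).and (h.eventually_gt_atTop 0)).exists

open Polynomial Filter in
lemma far_left (Q : ℝ[X]) (hQ : Q.Monic) (hd : 0 < Q.natDegree) (b : ℝ) :
    ∃ A, A < b ∧ 0 < (-1) ^ Q.natDegree * Q.eval A := by
  have hd' : (Q.comp (-X)).natDegree = Q.natDegree := by simp [natDegree_comp]
  have hm : (C ((-1) ^ Q.natDegree) * Q.comp (-X)).Monic := by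
    rw [Monic, leadingCoeff_mul, leadingCoeff_C, leadingCoeff_comp (by simp), hQ.leadingCoeff]
    simp [← mul_pow]
  obtain ⟨B, h1, h2⟩ := far_right _ hm (by
    rw [natDegree_C_mul (by simp), hd']; exact hd) (-b)
  refine ⟨-B, by linarith, ?_⟩
  simpa [eval_comp] using h2

open Polynomial in
/-- A monic polynomial with alternating signs at the nodes has a root in every interval. -/
lemma exists_roots (m : ℕ) (t : Fin m → ℝ) (ht : StrictMono t) (Q : ℝ[X]) (hQ : Q.Monic)
    (hQd : Q.natDegree = m + 1)
    (hs : ∀ j : Fin m, 0 < (-1 : ℝ) ^ (m - (j : ℕ)) * Q.eval (t j)) (k : Fin (m + 1)) :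
    ∃ x, Q.eval x = 0 ∧ ∀ j : Fin m, ((j : ℕ) < (k : ℕ) → t j < x) ∧
      ((k : ℕ) ≤ (j : ℕ) → x < t j) := by
  -- lower endpoint
  have hl : ∃ l, (∀ j : Fin m, (j : ℕ) < k → t j ≤ l) ∧ (∀ j : Fin m, (k : ℕ) ≤ j → l < t j) ∧
      0 < (-1 : ℝ) ^ (m + 1 - (k : ℕ)) * Q.eval l := by
    rcases Nat.eq_zero_or_pos (k : ℕ) with hk | hk
    · rcases Nat.eq_zero_or_pos m with hm | hm
      · obtain ⟨A, _, h2⟩ := far_left Q hQ (by omega) 0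
        refine ⟨A, fun j => absurd j.2 (by omega), fun j => absurd j.2 (by omega), ?_⟩
        rw [hk]; rw [hQd] at h2; simpa using h2
      · obtain ⟨A, h1, h2⟩ := far_left Q hQ (by omega) (t ⟨0, hm⟩)
        refine ⟨A, fun j hj => absurd hj (by omega),
          fun j _ => h1.trans_le (ht.monotone (Nat.zero_le _)), ?_⟩
        rw [hk]; rw [hQd] at h2; simpa using h2
    · have hkm : (k : ℕ) - 1 < m := by omega
      refine ⟨t ⟨k - 1, hkm⟩, fun j hj => ht.monotone (Fin.le_def.2 (by simp; omega)),
        fun j hj => ht (Fin.lt_def.2 (by simp; omega)), ?_⟩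
      have := hs ⟨k - 1, hkm⟩
      have e : m + 1 - (k : ℕ) = m - ((k : ℕ) - 1) := by omega
      rw [e]; exact this
  obtain ⟨l, hl1, hl2, hl3⟩ := hl
  have hu : ∃ u, l < u ∧ (∀ j : Fin m, (k : ℕ) ≤ j → u ≤ t j) ∧
      0 < (-1 : ℝ) ^ (m - (k : ℕ)) * Q.eval u := by
    by_cases hk : (k : ℕ) < m
    · exact ⟨t ⟨k, hk⟩, hl2 _ le_rfl, fun j hj => ht.monotone (Fin.le_def.2 hj), hs ⟨k, hk⟩⟩
    · obtain ⟨B, h1, h2⟩ := far_right Q hQ (by omega) l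
      refine ⟨B, h1, fun j hj => absurd j.2 (by omega), ?_⟩
      have e : m - (k : ℕ) = 0 := by omega
      rw [e]; simpa using h2
  obtain ⟨u, hlu, hu1, hu2⟩ := hu
  have e : m + 1 - (k : ℕ) = (m - (k : ℕ)) + 1 := by have := k.2; omega
  rw [e, pow_succ] at hl3
  have hroot : ∃ x ∈ Set.Ioo l u, Q.eval x = 0 := by
    have hc : ContinuousOn (fun x => Q.eval x) (Set.Icc l u) := Q.continuous.continuousOn
    rcases neg_one_pow_eq_or ℝ (m - (k : ℕ)) with h | h
    · rw [h] at hl3 hu2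
      exact intermediate_value_Ioo hlu.le hc ⟨by linarith, by linarith⟩
    · rw [h] at hl3 hu2
      exact intermediate_value_Ioo' hlu.le hc ⟨by linarith, by linarith⟩
  obtain ⟨x, hx, hx0⟩ := hroot
  exact ⟨x, hx0, fun j => ⟨fun h => (hl1 j h).trans_lt hx.1, fun h => hx.2.trans_le (hu1 j h)⟩⟩

lemma interlace_strictMono (m : ℕ) (t : Fin m → ℝ) (x y : Fin (m + 1) → ℝ)
    (hx : ∀ k : Fin (m + 1), ∀ j : Fin m,
        ((j : ℕ) < (k : ℕ) → t j < x k) ∧ ((k : ℕ) ≤ (j : ℕ) → x k < t j))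
    (hy : ∀ k : Fin (m + 1), ∀ j : Fin m,
        ((j : ℕ) < (k : ℕ) → t j < y k) ∧ ((k : ℕ) ≤ (j : ℕ) → y k < t j))
    (a b : Fin (m + 1)) (hab : a < b) : x a < y b := by
  have h : (a : ℕ) < m := by have := b.2; have := Fin.lt_def.1 hab; omega
  exact ((hx a ⟨a, h⟩).2 le_rfl).trans ((hy b ⟨a, h⟩).1 hab)

open Polynomial in
lemma core (m : ℕ) (hm : 1 ≤ m) (t σ : Fin m → ℝ) (lam : ℝ)
    (ht : StrictMono t) (hσ : ∀ j, 0 < σ j) (hlam : 0 < lam)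
    (k₀ : Fin (m + 1)) (x₀ : ℝ)
    (hx₀ : ∀ j : Fin m,
      ((j : ℕ) < (k₀ : ℕ) → t j < x₀) ∧ ((k₀ : ℕ) ≤ (j : ℕ) → x₀ < t j)) :
    ∃! xρ : (Fin (m + 1) → ℝ) × (Fin (m + 1) → ℝ),
      xρ.1 k₀ = x₀ ∧
      (∀ k : Fin (m + 1), ∀ j : Fin m,
        ((j : ℕ) < (k : ℕ) → t j < xρ.1 k) ∧ ((k : ℕ) ≤ (j : ℕ) → xρ.1 k < t j)) ∧
      (∀ k, 0 < xρ.2 k) ∧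
      (∀ k : ℕ, k < 2 * m + 1 → momL m t σ lam (X ^ k) = ∑ j, xρ.2 j * xρ.1 j ^ k) := by
  have hne : ∀ j, t j ≠ x₀ := fun j h => by
    rcases lt_or_ge (j : ℕ) (k₀ : ℕ) with h1 | h1
    · exact absurd ((hx₀ j).1 h1) (by rw [h]; exact lt_irrefl _)
    · exact absurd ((hx₀ j).2 h1) (by rw [h]; exact lt_irrefl _)
  set D : Fin m → ℝ := fun j => ∏ i ∈ univ.erase j, (t j - t i) with hD
  have hD0 : ∀ j, D j ≠ 0 := fun j => (mul_ne_zero_iff.1 (prod_erase_sign m t ht j).ne').2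
  refine existsUnique_of_exists_of_unique ?_ ?_
  · -- existence
    set R : ℝ[X] := Lagrange.interpolate univ t (fun j => (-lam / (σ j * D j)) / (t j - x₀)) with hR
    have hRd : R.degree < m := by
      have h := Lagrange.degree_interpolate_lt (s := univ) (v := t)
        (fun j => (-lam / (σ j * D j)) / (t j - x₀)) ht.injective.injOn
      rwa [card_univ, Fintype.card_fin] at h
    have hNd : (Lagrange.nodal univ t : ℝ[X]).degree = m := by
      rw [Lagrange.degree_nodal]; simp
    set S : ℝ[X] := Lagrange.nodal univ t + R with hS
    have hSm : S.Monic := (Lagrange.nodal_monic).add_of_left (by rw [hNd]; exact hRd)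
    have hSd : S.natDegree = m := by
      refine natDegree_eq_of_degree_eq_some ?_
      rw [hS, degree_add_eq_left_of_degree_lt (by rw [hNd]; exact hRd), hNd]
    set Q : ℝ[X] := (X - C x₀) * S with hQ
    have hQm : Q.Monic := (monic_X_sub_C x₀).mul hSm
    have hQd : Q.natDegree = m + 1 := by
      rw [hQ, (monic_X_sub_C x₀).natDegree_mul hSm, natDegree_X_sub_C, hSd, add_comm]
    have hQt : ∀ j, Q.eval (t j) = -lam / (σ j * D j) := fun j => by
      rw [hQ, hS, eval_mul, eval_add, Lagrange.eval_nodal_at_node (mem_univ j), hR,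
        Lagrange.eval_interpolate_at_node _ ht.injective.injOn (mem_univ j)]
      have := sub_ne_zero.2 (hne j)
      simp only [eval_sub, eval_X, eval_C, zero_add]
      field_simp
    have hQx : Q.eval x₀ = 0 := by simp [hQ]
    have hsign : ∀ j : Fin m, 0 < (-1 : ℝ) ^ (m - (j : ℕ)) * Q.eval (t j) := fun j => by
      have h1 := prod_erase_sign m t ht j
      have e : m - (j : ℕ) = (m - 1 - (j : ℕ)) + 1 := by have := j.2; omega
      rw [hQt, e, pow_succ]
      have h2 : (-1 : ℝ) ^ (m - 1 - (j : ℕ)) * -1 * (-lam / (σ j * D j)) =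
          (lam / σ j) * ((-1 : ℝ) ^ (m - 1 - (j : ℕ)) / D j) := by
        have := (hσ j).ne'; have := hD0 j; field_simp
      rw [h2]
      refine mul_pos (div_pos hlam (hσ j)) ?_
      have h3 : (-1 : ℝ) ^ (m - 1 - (j : ℕ)) / D j =
        ((-1 : ℝ) ^ (m - 1 - (j : ℕ)) * D j) / (D j) ^ 2 := by
        have := hD0 j; field_simp
      rw [h3]
      exact div_pos h1 (by have := hD0 j; positivity)
    have hroots : ∀ k : Fin (m + 1), ∃ x, (k = k₀ → x = x₀) ∧ Q.eval x = 0 ∧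
        ∀ j : Fin m, ((j : ℕ) < (k : ℕ) → t j < x) ∧ ((k : ℕ) ≤ (j : ℕ) → x < t j) := fun k => by
      by_cases hk : k = k₀
      · subst hk; exact ⟨x₀, fun _ => rfl, hQx, hx₀⟩
      · obtain ⟨x, h1, h2⟩ := exists_roots m t ht Q hQm hQd hsign k
        exact ⟨x, fun h => absurd h hk, h1, h2⟩
    choose x hxk hxr hxi using hroots
    have hxm : StrictMono x := fun a b h => interlace_strictMono m t x x hxi hxi a b h
    have horth : ∀ r : ℝ[X], r.degree < m → momL m t σ lam (Q * r) = 0 := fun r hr => by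
      rw [momL_mul m hm t σ lam ht Q hQm hQd r hr]
      refine sum_eq_zero fun j _ => ?_
      rw [hQt]
      have := (hσ j).ne'; have := hD0 j
      change (σ j * (-lam / (σ j * D j)) + lam / D j) * _ = 0
      rw [mul_eq_zero]; left; field_simp; ring
    set ℓ : Fin (m + 1) → ℝ[X] := fun k => Lagrange.basis univ x k with hℓ
    have hℓd : ∀ k, (ℓ k).natDegree = m := fun k => by
      rw [hℓ]; simp [Lagrange.natDegree_basis hxm.injective.injOn (mem_univ k)]
    have hquad : ∀ p : ℝ[X], p.natDegree ≤ 2 * m →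
        momL m t σ lam p = ∑ k, momL m t σ lam (ℓ k) * p.eval (x k) := fun p hp => by
      have h1 := modByMonic_add_div p Q
      have h2 : (p /ₘ Q).degree < m := by
        refine (natDegree_lt_iff_deg (by omega)).1 ?_
        rw [natDegree_divByMonic p hQm]; omega
      have h3 : (p %ₘ Q).degree < (m + 1 : ℕ) := by
        rw [← hQd, ← degree_eq_natDegree hQm.ne_zero]; exact degree_modByMonic_lt p hQm
      have h4 : p %ₘ Q = _ := Lagrange.eq_interpolate (s := univ) (v := x)
        hxm.injective.injOn (by simpa using h3)
      have h5 : ∀ k, (p %ₘ Q).eval (x k) = p.eval (x k) := fun k => by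
        conv_rhs => rw [← h1]
        rw [eval_add, eval_mul, hxr, zero_mul, add_zero]
      conv_lhs => rw [← h1]
      rw [map_add, horth _ h2, add_zero, h4, Lagrange.interpolate_apply, map_sum]
      refine sum_congr rfl fun k _ => ?_
      rw [← smul_eq_C_mul, map_smul, smul_eq_mul, h5, mul_comm]
    refine ⟨(x, fun k => momL m t σ lam (ℓ k)), hxk k₀ rfl, hxi, fun k => ?_, fun k hk => ?_⟩
    · have h1 := hquad (ℓ k * ℓ k) (by
        refine natDegree_mul_le.trans ?_; rw [hℓd]; omega)
      have h2 : ∑ i, momL m t σ lam (ℓ i) * (ℓ k * ℓ k).eval (x i) = momL m t σ lam (ℓ k) := by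
        rw [sum_eq_single k]
        · rw [eval_mul, hℓ]; simp [Lagrange.eval_basis_self hxm.injective.injOn (mem_univ k)]
        · intro i _ hik
          rw [eval_mul, hℓ]; simp [Lagrange.eval_basis_of_ne (Ne.symm hik) (mem_univ i)]
        · simp
      change 0 < momL m t σ lam (ℓ k)
      rw [← h2, ← h1, momL_apply]
      refine add_pos_of_nonneg_of_pos (sum_nonneg fun j _ => ?_) (mul_pos hlam ?_)
      · rw [eval_mul]; exact mul_nonneg (hσ j).le (mul_self_nonneg _)
      · rw [two_mul, coeff_mul_add_eq_of_natDegree_le (hℓd k).le (hℓd k).le]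
        have h0 : (ℓ k).coeff m ≠ 0 := by
          have h6 : (ℓ k).leadingCoeff ≠ 0 := leadingCoeff_ne_zero.2
            (Lagrange.basis_ne_zero hxm.injective.injOn (mem_univ k))
          rwa [leadingCoeff, hℓd] at h6
        exact mul_self_pos.2 h0
    · have := hquad (X ^ k) (by rw [natDegree_X_pow]; omega)
      simpa using this
  · -- uniqueness
    have hval : ∀ x ρ : Fin (m + 1) → ℝ,
        (∀ k : ℕ, k < 2 * m + 1 → momL m t σ lam (X ^ k) = ∑ j, ρ j * x j ^ k) →
        ∀ j, (Lagrange.nodal univ x).eval (t j) = -lam / (σ j * D j) := fun x ρ h j => by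
      have hb : (Lagrange.basis univ t j).degree < m := by
        rw [Lagrange.degree_basis ht.injective.injOn (mem_univ j), card_univ, Fintype.card_fin]
        exact_mod_cast (by omega : m - 1 < m)
      have hb' := (natDegree_lt_iff_deg (n := m) (by omega)).2 hb
      have hnd : (Lagrange.nodal univ x).natDegree = m + 1 := by simp
      have h1 := momL_mul m hm t σ lam ht (Lagrange.nodal univ x) Lagrange.nodal_monic hnd _ hb
      rw [momL_ext m t σ lam x ρ h _ (natDegree_mul_le.trans (by omega)), sum_eq_zero (fun k _ => by
        rw [eval_mul, Lagrange.eval_nodal_at_node (mem_univ k)]; simp), sum_eq_single j] at h1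
      · rw [Lagrange.eval_basis_self ht.injective.injOn (mem_univ j), mul_one] at h1
        change 0 = _ + lam / D j at h1
        have := (hσ j).ne'; have := hD0 j
        field_simp at h1 ⊢
        linarith
      · intro i _ hij
        rw [Lagrange.eval_basis_of_ne (Ne.symm hij) (mem_univ i), mul_zero]
      · simp
    rintro ⟨x, ρ⟩ ⟨y, τ⟩ ⟨hx1, hx2, -, hx4⟩ ⟨hy1, hy2, -, hy4⟩
    simp only at hx1 hx2 hx4 hy1 hy2 hy4
    have hxm : StrictMono x := fun a b h => interlace_strictMono m t x x hx2 hx2 a b h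
    have hQ : Lagrange.nodal univ x = Lagrange.nodal univ y := by
      refine eq_of_degree_sub_lt_of_eval_finset_eq (insert x₀ (univ.image t)) ?_ ?_
      · have hcard : (insert x₀ (univ.image t)).card = m + 1 := by
          rw [card_insert_of_notMem (by simpa using hne), card_image_of_injective _ ht.injective]
          simp
        rw [hcard]
        refine (degree_sub_lt (by simp [Lagrange.degree_nodal]) Lagrange.nodal_ne_zero
          (by rw [Lagrange.nodal_monic.leadingCoeff, Lagrange.nodal_monic.leadingCoeff])).trans_eq ?_
        simp [Lagrange.degree_nodal]
      · intro z hz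
        rw [mem_insert, mem_image] at hz
        rcases hz with rfl | ⟨j, -, rfl⟩
        · nth_rewrite 1 [← hx1]
          rw [← hy1, Lagrange.eval_nodal_at_node (mem_univ k₀),
            Lagrange.eval_nodal_at_node (mem_univ k₀)]
        · rw [hval x ρ hx4, hval y τ hy4]
    have hxy : x = y := by
      funext k
      have h1 : (Lagrange.nodal univ y).eval (x k) = 0 := by
        rw [← hQ]; exact Lagrange.eval_nodal_at_node (mem_univ k)
      rw [Lagrange.eval_nodal, prod_eq_zero_iff] at h1
      obtain ⟨i, -, hi⟩ := h1
      rw [sub_eq_zero] at hi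
      rcases lt_trichotomy k i with h | h | h
      · exact absurd hi (interlace_strictMono m t x y hx2 hy2 k i h).ne
      · rw [hi, h]
      · exact absurd hi (interlace_strictMono m t y x hy2 hx2 i k h).ne'
    subst hxy
    have hw : ∀ ω : Fin (m + 1) → ℝ,
        (∀ k : ℕ, k < 2 * m + 1 → momL m t σ lam (X ^ k) = ∑ j, ω j * x j ^ k) →
        ∀ k, ω k = momL m t σ lam (Lagrange.basis univ x k) := fun ω h k => by
      rw [momL_ext m t σ lam x ω h _ (by
        rw [Lagrange.natDegree_basis hxm.injective.injOn (mem_univ k)]; simp; omega),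
        sum_eq_single k]
      · simp [Lagrange.eval_basis_self hxm.injective.injOn (mem_univ k)]
      · intro i _ hik
        rw [Lagrange.eval_basis_of_ne (Ne.symm hik) (mem_univ i), mul_zero]
      · simp
    have : ρ = τ := by funext k; rw [hw ρ hx4, hw τ hy4]
    rw [this]

/-- **Theorem 3 (ii).** Let `c` be in the interior of the moment cone with canonical
representation of roots `t_1 < … < t_{n-1}`, weights `σ_j > 0` and mass `λ > 0` at
infinity (with `t_0 = -∞`, `t_n = +∞`). Fix `k₀` and a point `x₀ ∈ (t (k₀-1), t k₀)`.
Then there are unique roots `x_k ∈ (t (k-1), t k)` for the remaining indices and unique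
weights `ϱ_1, …, ϱ_n > 0` such that `c_k = ∑ ϱ_j x_j^k` for all `k = 0, …, 2n-2`. -/
theorem canonical_representation_principal
    (n : ℕ) (hn : 2 ≤ n) (c : Fin (2 * n - 1) → ℝ) (hc : (hankel n c).PosDef)
    (t σ : Fin (n - 1) → ℝ) (lam : ℝ)
    (ht : StrictMono t) (hσ : ∀ j, 0 < σ j) (hlam : 0 < lam)
    (hrep : ∀ k : Fin (2 * n - 1), (k : ℕ) < 2 * n - 2 →
      c k = ∑ j, σ j * t j ^ (k : ℕ))
    (hrep' : c ⟨2 * n - 2, by omega⟩ = (∑ j, σ j * t j ^ (2 * n - 2)) + lam)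
    (k₀ : Fin n) (x₀ : ℝ)
    (hx₀ : ∀ j : Fin (n - 1),
      ((j : ℕ) < (k₀ : ℕ) → t j < x₀) ∧ ((k₀ : ℕ) ≤ (j : ℕ) → x₀ < t j)) :
    ∃! xρ : (Fin n → ℝ) × (Fin n → ℝ),
      xρ.1 k₀ = x₀ ∧
      (∀ k : Fin n, ∀ j : Fin (n - 1),
        ((j : ℕ) < (k : ℕ) → t j < xρ.1 k) ∧ ((k : ℕ) ≤ (j : ℕ) → xρ.1 k < t j)) ∧
      (∀ k, 0 < xρ.2 k) ∧
      (∀ k : Fin (2 * n - 1), c k = ∑ j, xρ.2 j * xρ.1 j ^ (k : ℕ)) := by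
  obtain ⟨m, rfl⟩ : ∃ m, n = m + 1 := ⟨n - 1, by omega⟩
  have hm : 1 ≤ m := by omega
  have key := core m hm t σ lam ht hσ hlam k₀ x₀ hx₀
  have hck : ∀ k : Fin (2 * (m + 1) - 1),
      c k = momL m t σ lam (Polynomial.X ^ (k : ℕ)) := fun k => by
    rw [momL_apply]
    simp only [Polynomial.eval_pow, Polynomial.eval_X, Polynomial.coeff_X_pow]
    by_cases hk : (k : ℕ) < 2 * (m + 1) - 2
    · rw [hrep k hk, if_neg (by omega), mul_zero, add_zero]
      rfl
    · have hk2 : (k : ℕ) = 2 * m := by have := k.2; omega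
      have hk3 : k = ⟨2 * (m + 1) - 2, by omega⟩ := Fin.ext (by simp only []; omega)
      rw [if_pos hk2.symm, mul_one]
      conv_lhs => rw [hk3, hrep']
      rw [hk2]
      rfl
  refine (existsUnique_congr fun xρ => ?_).1 key
  refine and_congr_right fun _ => and_congr_right fun _ => and_congr_right fun _ => ?_
  constructor
  · intro h k
    rw [hck]; exact h k (by have := k.2; omega)
  · intro h k hk
    rw [← h ⟨k, by omega⟩, hck]
end

section
/- Let n ≥ 2. The Nesterov map N, defined by N(c) := H*(H(c)^{-1}), is a bijection from the set {c ∈ ℝ^{2n-1} : H(c) is positive definite} onto the set of vectors p = (p_0, …, p_{2n-2}) ∈ ℝ^{2n-1} such that p_{2n-2} > 0 and the polynomial p(x) = p_0 + p_1 x + … + p_{2n-2} x^{2n-2} satisfies p(x) > 0 for all x ∈ ℝ. -/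
open Finset

/-- The dual map `H*`, sending an `n × n` matrix `X` to the vector of its
anti-diagonal sums, `(H*(X))_k = ∑_{i+j=k} X_{ij}`. -/
def hankelStar (n : ℕ) (M : Matrix (Fin n) (Fin n) ℝ) : Fin (2 * n - 1) → ℝ :=
  fun k => ∑ i : Fin n, ∑ j : Fin n, if (i : ℕ) + (j : ℕ) = (k : ℕ) then M i j else 0

/-- A functional nonnegative on squares is nonnegative on nonnegative polynomials. -/
lemma functional_nonneg (d : ℕ) : ∀ L : Polynomial ℝ →ₗ[ℝ] ℝ,
    (∀ r : Polynomial ℝ, r.natDegree ≤ d → 0 ≤ L (r * r)) →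
    ∀ q : Polynomial ℝ, q.natDegree ≤ 2 * d → (∀ x, 0 ≤ q.eval x) → 0 ≤ L q := by
  induction d with
  | zero =>
    intro L hL q hq hpos
    have h1 := hL 1 (by simp)
    have hc : q = Polynomial.C (q.coeff 0) := Polynomial.eq_C_of_natDegree_le_zero (by simpa using hq)
    have h0 : 0 ≤ q.coeff 0 := by
      have := hpos 0
      rw [hc] at this; simpa using this
    rw [hc, ← mul_one (Polynomial.C _), ← Polynomial.smul_eq_C_mul, map_smul, smul_eq_mul]
    rw [mul_one] at h1
    exact mul_nonneg h0 h1
  | succ d ih =>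
    intro L hL q hq hpos
    obtain ⟨a, ha⟩ := q.exists_forall_norm_le
    have hmin : ∀ y, q.eval a ≤ q.eval y := fun y => by
      have := ha y
      rwa [Real.norm_of_nonneg (hpos _), Real.norm_of_nonneg (hpos _)] at this
    set m := q.eval a with hm
    have hroot : (q - Polynomial.C m).IsRoot a := by simp [Polynomial.IsRoot, hm]
    obtain ⟨h, hh⟩ := Polynomial.dvd_iff_isRoot.mpr hroot
    have hder : h.eval a = 0 := by
      have hd : Polynomial.derivative q = h + (Polynomial.X - Polynomial.C a) * Polynomial.derivative h := by
        have := congrArg Polynomial.derivative hh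
        simpa using this
      have hloc : IsLocalMin (fun x => q.eval x) a := Filter.Eventually.of_forall hmin
      have := hloc.deriv_eq_zero
      rw [Polynomial.deriv, hd] at this
      simpa using this
    obtain ⟨g, hg⟩ := Polynomial.dvd_iff_isRoot.mpr hder
    have hq2 : q = Polynomial.C m + (Polynomial.X - Polynomial.C a) * (Polynomial.X - Polynomial.C a) * g := by
      rw [mul_assoc, ← hg, ← hh]; ring
    have hgpos0 : ∀ x, x ≠ a → 0 ≤ g.eval x := by
      intro x hx
      have h1 := hmin x
      have h2 : q.eval x = m + (x - a) * (x - a) * g.eval x := by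
        conv_lhs => rw [hq2]
        simp
      have h3 : 0 < (x - a) * (x - a) := mul_self_pos.mpr (sub_ne_zero.mpr hx)
      by_contra hneg
      push Not at hneg
      nlinarith
    have hgpos : ∀ x, 0 ≤ g.eval x := by
      intro x
      have hcl : IsClosed {x | 0 ≤ g.eval x} := isClosed_le continuous_const g.continuous
      have hd : Dense ({a}ᶜ : Set ℝ) := dense_compl_singleton a
      have : closure ({a}ᶜ : Set ℝ) ⊆ {x | 0 ≤ g.eval x} :=
        closure_minimal (fun x hx => hgpos0 x hx) hcl
      exact this (hd x)
    have hgdeg : g.natDegree ≤ 2 * d := by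
      by_cases hg0 : g = 0
      · simp [hg0]
      have h1 : (q - Polynomial.C m).natDegree = 2 + g.natDegree := by
        rw [hh, hg, Polynomial.natDegree_mul (Polynomial.X_sub_C_ne_zero a)
          (mul_ne_zero (Polynomial.X_sub_C_ne_zero a) hg0),
          Polynomial.natDegree_mul (Polynomial.X_sub_C_ne_zero a) hg0]
        simp; ring
      have h2 : (q - Polynomial.C m).natDegree ≤ q.natDegree := by
        simp
      omega
    let L' : Polynomial ℝ →ₗ[ℝ] ℝ :=
      L.comp (LinearMap.mulLeft ℝ ((Polynomial.X - Polynomial.C a) * (Polynomial.X - Polynomial.C a)))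
    have hL' : 0 ≤ L' g := by
      apply ih L' _ g hgdeg hgpos
      intro r hr
      have := hL ((Polynomial.X - Polynomial.C a) * r) (by
        refine Polynomial.natDegree_mul_le.trans ?_
        rw [Polynomial.natDegree_X_sub_C]; omega)
      simp only [L', LinearMap.comp_apply, LinearMap.mulLeft_apply]
      convert this using 2
      ring
    have h1 := hL 1 (by simp)
    rw [mul_one] at h1
    have : L q = m * L 1 + L' g := by
      conv_lhs => rw [hq2]
      rw [map_add, ← mul_one (Polynomial.C m), ← Polynomial.smul_eq_C_mul, map_smul, smul_eq_mul]
      rfl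
    rw [this]
    exact add_nonneg (mul_nonneg (hpos a) h1) hL'

/-- Strictly positive polynomial dominates a multiple of `∑ x^{2i}`. -/
lemma exists_eps (n : ℕ) (hn : 2 ≤ n) (hk : 2 * n - 2 < 2 * n - 1) (p : Fin (2 * n - 1) → ℝ)
    (h0 : 0 < p ⟨2 * n - 2, hk⟩)
    (hp : ∀ x : ℝ, 0 < ∑ k : Fin (2 * n - 1), p k * x ^ (k : ℕ)) :
    ∃ ε : ℝ, 0 < ε ∧ ∀ x : ℝ, ε * ∑ i : Fin n, x ^ (2 * (i : ℕ)) ≤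
      ∑ k : Fin (2 * n - 1), p k * x ^ (k : ℕ) := by
  have hrev : ∀ x : ℝ, x ≠ 0 → ∑ k : Fin (2 * n - 1), p k * x ^ (k : ℕ) =
      x ^ (2 * n - 2) * ∑ k : Fin (2 * n - 1), p k * x⁻¹ ^ (2 * n - 2 - (k : ℕ)) := by
    intro x hx
    rw [Finset.mul_sum]
    refine Finset.sum_congr rfl fun k _ => ?_
    have hk : (k : ℕ) + (2 * n - 2 - (k : ℕ)) = 2 * n - 2 := by have := k.isLt; omega
    have : x ^ (2 * n - 2) = x ^ (k : ℕ) * x ^ (2 * n - 2 - (k : ℕ)) := by rw [← pow_add, hk]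
    rw [this, inv_pow]
    field_simp
  have hrevpos : ∀ y : ℝ, 0 < ∑ k : Fin (2 * n - 1), p k * y ^ (2 * n - 2 - (k : ℕ)) := by
    intro y
    by_cases hy : y = 0
    · subst hy
      rw [Finset.sum_eq_single (⟨2 * n - 2, hk⟩ : Fin (2 * n - 1))]
      · simpa using h0
      · intro b _ hb
        have hb' : (b : ℕ) ≠ 2 * n - 2 := fun h => hb (Fin.ext h)
        have := b.isLt
        rw [zero_pow (by omega), mul_zero]
      · simp
    · have h1 := hp y⁻¹
      rw [hrev _ (inv_ne_zero hy), inv_inv] at h1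
      have h2 : 0 < y⁻¹ ^ (2 * n - 2) := by
        apply Even.pow_pos _ (inv_ne_zero hy)
        exact ⟨n - 1, by omega⟩
      exact (mul_pos_iff_of_pos_left h2).mp h1
  obtain ⟨a, -, ha⟩ := (isCompact_Icc (a := (-1 : ℝ)) (b := 1)).exists_isMinOn ⟨0, by norm_num⟩
    (f := fun x : ℝ => ∑ k : Fin (2 * n - 1), p k * x ^ (k : ℕ)) (by fun_prop)
  obtain ⟨b, -, hb⟩ := (isCompact_Icc (a := (-1 : ℝ)) (b := 1)).exists_isMinOn ⟨0, by norm_num⟩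
    (f := fun x : ℝ => ∑ k : Fin (2 * n - 1), p k * x ^ (2 * n - 2 - (k : ℕ))) (by fun_prop)
  set ma := ∑ k : Fin (2 * n - 1), p k * a ^ (k : ℕ) with hma
  set mb := ∑ k : Fin (2 * n - 1), p k * b ^ (2 * n - 2 - (k : ℕ)) with hmb
  have hmap : 0 < ma := hp a
  have hmbp : 0 < mb := hrevpos b
  have hnpos : (0 : ℝ) < n := by exact_mod_cast (by omega : 0 < n)
  have hdiv : min ma mb / n * n = min ma mb := by field_simp
  refine ⟨min ma mb / n, div_pos (lt_min hmap hmbp) hnpos, fun x => ?_⟩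
  have hε : 0 < min ma mb / n := div_pos (lt_min hmap hmbp) hnpos
  by_cases hx : |x| ≤ 1
  · have h1 : ma ≤ ∑ k : Fin (2 * n - 1), p k * x ^ (k : ℕ) := ha (abs_le.mp hx)
    have h2 : ∑ i : Fin n, x ^ (2 * (i : ℕ)) ≤ n := by
      calc _ ≤ ∑ i : Fin n, (1 : ℝ) := Finset.sum_le_sum fun i _ => by
            rw [pow_mul]; exact pow_le_one₀ (sq_nonneg x) (by rwa [sq_le_one_iff_abs_le_one])
        _ = n := by simp
    calc _ ≤ min ma mb / n * n := by gcongr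
      _ = min ma mb := hdiv
      _ ≤ ma := min_le_left _ _
      _ ≤ _ := h1
  · push Not at hx
    have hx0 : x ≠ 0 := by rintro rfl; simp at hx; linarith
    have hinv : |x⁻¹| ≤ 1 := by rw [abs_inv]; exact inv_le_one_of_one_le₀ hx.le
    have h1 : mb ≤ ∑ k : Fin (2 * n - 1), p k * x⁻¹ ^ (2 * n - 2 - (k : ℕ)) := hb (abs_le.mp hinv)
    have hP : 0 ≤ x ^ (2 * n - 2) := Even.pow_nonneg ⟨n - 1, by omega⟩ x
    have h2 : ∑ i : Fin n, x ^ (2 * (i : ℕ)) ≤ n * x ^ (2 * n - 2) := by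
      calc _ ≤ ∑ i : Fin n, x ^ (2 * n - 2) := Finset.sum_le_sum fun i _ => by
            have : 2 * n - 2 = 2 * (n - 1) := by omega
            rw [this, pow_mul, pow_mul]
            apply pow_le_pow_right₀
            · rw [one_le_sq_iff_one_le_abs]; exact hx.le
            · have := i.isLt; omega
        _ = _ := by simp
    rw [hrev x hx0]
    calc _ ≤ min ma mb / n * (n * x ^ (2 * n - 2)) := by gcongr
      _ = x ^ (2 * n - 2) * min ma mb := by rw [← mul_assoc, hdiv, mul_comm]
      _ ≤ x ^ (2 * n - 2) * mb := by gcongr; exact min_le_right _ _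
      _ ≤ _ := by gcongr

lemma hankel_apply (n : ℕ) (c : Fin (2 * n - 1) → ℝ) (i j : Fin n) :
    hankel n c i j = c ⟨(i : ℕ) + (j : ℕ), by have hi := i.isLt; have hj := j.isLt; omega⟩ := rfl

lemma hankel_isHermitian (n : ℕ) (c : Fin (2 * n - 1) → ℝ) : (hankel n c).IsHermitian := by
  ext i j
  simp [hankel_apply, add_comm]

lemma hankel_add (n : ℕ) (c d : Fin (2 * n - 1) → ℝ) :
    hankel n (c + d) = hankel n c + hankel n d := rfl

lemma hankel_sub (n : ℕ) (c d : Fin (2 * n - 1) → ℝ) :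
    hankel n (c - d) = hankel n c - hankel n d := rfl

lemma hankel_smul (n : ℕ) (t : ℝ) (c : Fin (2 * n - 1) → ℝ) :
    hankel n (t • c) = t • hankel n c := rfl

lemma hankel_continuous (n : ℕ) : Continuous (hankel n) := by
  refine continuous_matrix fun i j => ?_
  exact continuous_apply _

lemma hankel_injective (n : ℕ) (hn : 2 ≤ n) (c : Fin (2 * n - 1) → ℝ) (h : hankel n c = 0) : c = 0 := by
  ext k
  have hk := k.isLt
  by_cases hk2 : (k : ℕ) < n
  · have := congrFun (congrFun h ⟨k, hk2⟩) ⟨0, by omega⟩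
    simpa [hankel_apply] using this
  · have := congrFun (congrFun h ⟨n - 1, by omega⟩) ⟨k - (n - 1), by omega⟩
    rw [hankel_apply] at this
    simp only [Matrix.zero_apply] at this
    simp only [Pi.zero_apply, ← this]
    congr 1
    ext; simp; omega

/-- Pairing with sums weighted. -/
lemma hankelStar_pair (n : ℕ) (X : Matrix (Fin n) (Fin n) ℝ) (f : ℕ → ℝ) :
    ∑ k, hankelStar n X k * f k = ∑ i, ∑ j, X i j * f ((i : ℕ) + (j : ℕ)) := by
  simp only [hankelStar, Finset.sum_mul]
  rw [Finset.sum_comm]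
  refine Finset.sum_congr rfl fun i _ => ?_
  rw [Finset.sum_comm]
  refine Finset.sum_congr rfl fun j _ => ?_
  rw [Finset.sum_eq_single (⟨(i : ℕ) + (j : ℕ), by have hi := i.isLt; have hj := j.isLt; omega⟩ : Fin (2 * n - 1))]
  · simp
  · intro b _ hb
    have : (i : ℕ) + (j : ℕ) ≠ b := fun h => hb (Fin.ext h.symm)
    simp [this]
  · simp

lemma hankelStar_pair_trace (n : ℕ) (X : Matrix (Fin n) (Fin n) ℝ) (c : Fin (2 * n - 1) → ℝ) :
    ∑ k, hankelStar n X k * c k = (X * hankel n c).trace := by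
  have := hankelStar_pair n X (fun k => if h : k < 2 * n - 1 then c ⟨k, h⟩ else 0)
  simp only [Fin.is_lt, dite_true] at this
  rw [this, Matrix.trace]
  refine Finset.sum_congr rfl fun i _ => ?_
  rw [Matrix.diag_apply, Matrix.mul_apply]
  refine Finset.sum_congr rfl fun j _ => ?_
  have : (i : ℕ) + (j : ℕ) < 2 * n - 1 := by have hi := i.isLt; have hj := j.isLt; omega
  rw [dif_pos this, hankel_apply]
  simp [add_comm]

/-- The moment functional. -/
noncomputable def momentL (n : ℕ) (c : Fin (2 * n - 1) → ℝ) : Polynomial ℝ →ₗ[ℝ] ℝ :=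
  ∑ k : Fin (2 * n - 1), c k • Polynomial.lcoeff ℝ (k : ℕ)

lemma momentL_apply (n : ℕ) (c : Fin (2 * n - 1) → ℝ) (q : Polynomial ℝ) :
    momentL n c q = ∑ k : Fin (2 * n - 1), c k * q.coeff k := by
  simp [momentL, LinearMap.sum_apply]

lemma momentL_X_pow (n : ℕ) (c : Fin (2 * n - 1) → ℝ) (k : Fin (2 * n - 1)) :
    momentL n c (Polynomial.X ^ (k : ℕ)) = c k := by
  rw [momentL_apply, Finset.sum_eq_single k]
  · simp
  · intro b _ hb
    rw [Polynomial.coeff_X_pow, if_neg (fun h => hb (Fin.ext h)), mul_zero]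
  · simp

lemma momentL_sq (n : ℕ) (hn : 2 ≤ n) (c : Fin (2 * n - 1) → ℝ) (r : Polynomial ℝ)
    (hr : r.natDegree ≤ n - 1) :
    momentL n c (r * r) = (fun i : Fin n => r.coeff i) ⬝ᵥ
      (hankel n c).mulVec (fun i : Fin n => r.coeff i) := by
  have hr' : r = ∑ i : Fin n, r.coeff i • Polynomial.X ^ (i : ℕ) := by
    conv_lhs => rw [r.as_sum_range' n (by omega)]
    rw [← Fin.sum_univ_eq_sum_range (fun i => Polynomial.monomial i (r.coeff i))]
    refine Finset.sum_congr rfl fun i _ => ?_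
    rw [Polynomial.smul_eq_C_mul, Polynomial.C_mul_X_pow_eq_monomial]
  conv_lhs => rw [hr']
  rw [Finset.sum_mul_sum, map_sum]
  simp only [dotProduct, Matrix.mulVec, Finset.mul_sum]
  refine Finset.sum_congr rfl fun i _ => ?_
  rw [map_sum]
  refine Finset.sum_congr rfl fun j _ => ?_
  rw [smul_mul_smul_comm, ← pow_add, map_smul, hankel_apply, smul_eq_mul]
  rw [momentL_X_pow n c ⟨(i : ℕ) + (j : ℕ), by have hi := i.isLt; have hj := j.isLt; omega⟩]
  ring

/-- Coercivity: `⟨p, c⟩ ≥ ε tr H(c)`. -/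
lemma pair_ge (n : ℕ) (hn : 2 ≤ n) (p : Fin (2 * n - 1) → ℝ) (ε : ℝ)
    (hε : ∀ x : ℝ, ε * ∑ i : Fin n, x ^ (2 * (i : ℕ)) ≤ ∑ k : Fin (2 * n - 1), p k * x ^ (k : ℕ))
    (c : Fin (2 * n - 1) → ℝ) (hc : (hankel n c).PosSemidef) :
    ε * (hankel n c).trace ≤ ∑ k, p k * c k := by
  let q : Polynomial ℝ := ∑ k : Fin (2 * n - 1), p k • Polynomial.X ^ (k : ℕ) -
    ε • ∑ i : Fin n, Polynomial.X ^ (2 * (i : ℕ))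
  have hq : q.natDegree ≤ 2 * (n - 1) := by
    refine (Polynomial.natDegree_sub_le _ _).trans (max_le ?_ ?_)
    · refine Polynomial.natDegree_sum_le_of_forall_le _ _ fun k _ => ?_
      refine (Polynomial.natDegree_smul_le _ _).trans ?_
      rw [Polynomial.natDegree_X_pow]; have := k.isLt; omega
    · refine (Polynomial.natDegree_smul_le _ _).trans ?_
      refine Polynomial.natDegree_sum_le_of_forall_le _ _ fun k _ => ?_
      rw [Polynomial.natDegree_X_pow]; have := k.isLt; omega
  have h := functional_nonneg (n - 1) (momentL n c) (fun r hr => by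
    rw [momentL_sq n hn c r hr]
    simpa using hc.dotProduct_mulVec_nonneg (fun i : Fin n => r.coeff i)) q hq (fun x => by
      have := hε x
      simp only [q, Polynomial.eval_sub, Polynomial.eval_finsetSum, Polynomial.eval_smul,
        Polynomial.eval_pow, Polynomial.eval_X, smul_eq_mul]
      linarith)
  have h2 : momentL n c q = ∑ k, p k * c k - ε * (hankel n c).trace := by
    simp only [q, map_sub, map_sum, map_smul, momentL_X_pow, smul_eq_mul]
    congr 2
    rw [Matrix.trace]
    refine Finset.sum_congr rfl fun i _ => ?_
    rw [momentL_X_pow n c ⟨2 * (i : ℕ), by have hi := i.isLt; omega⟩, Matrix.diag_apply, hankel_apply]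
    congr 2
    ring
  linarith

lemma entry_le_trace {n : ℕ} {A : Matrix (Fin n) (Fin n) ℝ} (hA : A.PosSemidef) (i j : Fin n) :
    |A i j| ≤ A.trace := by
  have hd : ∀ i, A i i ≤ A.trace := fun i =>
    Finset.single_le_sum (f := fun i => A i i) (fun i _ => hA.diag_nonneg) (Finset.mem_univ i)
  have hs : A j i = A i j := by simpa using hA.isHermitian.apply i j
  have key : ∀ t : ℝ, 0 ≤ A i i + 2 * t * A i j + t ^ 2 * A j j := by
    intro t
    have := hA.dotProduct_mulVec_nonneg (Pi.single i 1 + t • Pi.single j 1)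
    simp [Matrix.mulVec_add, Matrix.mulVec_smul, add_dotProduct, dotProduct_add, hs] at this
    linarith
  have h1 := key 1
  have h2 := key (-1)
  have h3 := hd i
  have h4 := hd j
  rw [abs_le]
  constructor <;> linarith

lemma posDef_perturb {n : ℕ} {A E : Matrix (Fin n) (Fin n) ℝ} (hA : A.PosDef) (hE : E.IsHermitian) :
    ∀ᶠ t : ℝ in nhds 0, (A + t • E).PosSemidef := by
  have hK : IsCompact (Metric.sphere (0 : Fin n → ℝ) 1) := isCompact_sphere _ _
  have hcont : Continuous fun z : ℝ × (Fin n → ℝ) => z.2 ⬝ᵥ ((A + z.1 • E).mulVec z.2) := by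
    fun_prop
  have hev : ∀ᶠ t : ℝ in nhds 0, ∀ x ∈ Metric.sphere (0 : Fin n → ℝ) 1,
      0 < x ⬝ᵥ ((A + t • E).mulVec x) := by
    apply hK.eventually_forall_of_forall_eventually
    intro x hx
    have hx0 : x ≠ 0 := by
      rintro rfl; simp at hx
    have h0 := hA.dotProduct_mulVec_pos hx0
    have : 0 < (fun z : ℝ × (Fin n → ℝ) => z.2 ⬝ᵥ ((A + z.1 • E).mulVec z.2)) ((0 : ℝ), x) := by
      simpa using h0
    exact hcont.continuousAt.eventually (lt_mem_nhds this)
  filter_upwards [hev] with t ht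
  refine Matrix.PosSemidef.of_dotProduct_mulVec_nonneg (hA.isHermitian.add ?_) fun x => ?_
  · rw [Matrix.IsHermitian, Matrix.conjTranspose_smul, hE.eq]; simp
  · by_cases hx : x = 0
    · simp [hx]
    have hnx : ‖x‖ ≠ 0 := norm_ne_zero_iff.mpr hx
    have := ht (‖x‖⁻¹ • x) (by simp [norm_smul, hnx])
    rw [Matrix.mulVec_smul, smul_dotProduct, dotProduct_smul, smul_eq_mul, smul_eq_mul, ← mul_assoc] at this
    have h2 : 0 < ‖x‖⁻¹ * ‖x‖⁻¹ := by positivity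
    simpa using ((mul_pos_iff_of_pos_left h2).mp this).le

lemma exists_posDef (n : ℕ) : ∃ c, (hankel n c).PosDef := by
  refine ⟨fun k => ∑ t : Fin n, ((t : ℕ) : ℝ) ^ (k : ℕ), ?_⟩
  set V : Matrix (Fin n) (Fin n) ℝ := Matrix.vandermonde fun t : Fin n => ((t : ℕ) : ℝ) with hV
  have hVd : V.det ≠ 0 := Matrix.det_vandermonde_ne_zero_iff.mpr fun a b h => by
    simpa [Fin.ext_iff] using h
  have h1 : hankel n (fun k => ∑ t : Fin n, ((t : ℕ) : ℝ) ^ (k : ℕ)) = V.conjTranspose * V := by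
    ext i j
    simp [hankel_apply, Matrix.mul_apply, hV, Matrix.vandermonde_apply, pow_add]
  rw [h1]
  refine Matrix.PosDef.conjTranspose_mul_self V (Matrix.mulVec_injective_iff_isUnit.mpr ?_)
  rw [Matrix.isUnit_iff_isUnit_det]
  exact isUnit_iff_ne_zero.mpr hVd

lemma isClosed_psd (n : ℕ) : IsClosed {c : Fin (2 * n - 1) → ℝ | (hankel n c).PosSemidef} := by
  have : {c : Fin (2 * n - 1) → ℝ | (hankel n c).PosSemidef} =
      ⋂ x : Fin n → ℝ, {c | 0 ≤ x ⬝ᵥ (hankel n c).mulVec x} := by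
    ext c
    simp only [Set.mem_ofPred_eq, Set.mem_iInter, Matrix.posSemidef_iff_dotProduct_mulVec,
      hankel_isHermitian, true_and, star_trivial]
  rw [this]
  refine isClosed_iInter fun x => isClosed_le continuous_const ?_
  have := hankel_continuous n
  fun_prop


open scoped MatrixOrder ComplexOrder in
lemma posDef_factor {n : ℕ} {A : Matrix (Fin n) (Fin n) ℝ} (hA : A.PosDef) :
    ∃ S : Matrix (Fin n) (Fin n) ℝ, IsUnit S ∧ A = S.conjTranspose * S := by
  let _ : NormedRing (Matrix (Fin n) (Fin n) ℝ) := Matrix.instL2OpNormedRing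
  let _ : NormedAlgebra ℝ (Matrix (Fin n) (Fin n) ℝ) := Matrix.instL2OpNormedAlgebra
  let _ : CStarRing (Matrix (Fin n) (Fin n) ℝ) := Matrix.instCStarRing
  obtain ⟨y, hy, h⟩ := CStarAlgebra.isStrictlyPositive_iff_eq_star_mul_self.mp hA.isStrictlyPositive
  exact ⟨y, hy, h⟩

lemma trace_inj {n : ℕ} {A B D : Matrix (Fin n) (Fin n) ℝ} (hA : A.PosDef) (hB : B.PosDef)
    (hD : D.IsHermitian) (h : (A * D * B * D).trace = 0) : D = 0 := by
  obtain ⟨S, hS, rfl⟩ := posDef_factor hA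
  obtain ⟨T, hT, rfl⟩ := posDef_factor hB
  have h1 : ((S * D * T.conjTranspose).conjTranspose * (S * D * T.conjTranspose)).trace = 0 := by
    rw [← h, Matrix.conjTranspose_mul, Matrix.conjTranspose_mul, hD.eq, Matrix.conjTranspose_conjTranspose]
    rw [show S.conjTranspose * S * D * (T.conjTranspose * T) * D =
      (S.conjTranspose * S * D * T.conjTranspose) * (T * D) by simp only [mul_assoc]]
    rw [Matrix.trace_mul_comm (S.conjTranspose * S * D * T.conjTranspose)]
    simp only [mul_assoc]
  have h2 := Matrix.trace_conjTranspose_mul_self_eq_zero_iff.mp h1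
  have hT' : IsUnit T.conjTranspose := hT.star
  rw [hT'.mul_left_eq_zero, hS.mul_right_eq_zero] at h2
  exact h2

lemma trace_eq_zero_of_det_le {n : ℕ} {A E : Matrix (Fin n) (Fin n) ℝ} (hA : A.PosDef)
    (h : ∀ᶠ t : ℝ in nhds 0, (A + t • E).det ≤ A.det) : (A⁻¹ * E).trace = 0 := by
  have hu : IsUnit A.det := hA.det_pos.ne'.isUnit
  have hfac : ∀ t : ℝ, (A + t • E).det = A.det * (1 + t • (A⁻¹ * E)).det := by
    intro t
    rw [← Matrix.det_mul, mul_add, mul_one, Matrix.mul_smul, Matrix.mul_nonsing_inv_cancel_left _ _ hu]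
  set R : Polynomial ℝ :=
    (1 + (Polynomial.X : Polynomial ℝ) • (A⁻¹ * E).map Polynomial.C).det.divX.divX with hR
  set P : Polynomial ℝ := 1 + Polynomial.C (A⁻¹ * E).trace * Polynomial.X + R * Polynomial.X ^ 2 with hP
  have hPe : ∀ t : ℝ, P.eval t = (1 + t • (A⁻¹ * E)).det := by
    intro t
    rw [Matrix.det_one_add_smul, hP]
    simp [hR]
  have hloc : IsLocalMax (fun t => P.eval t) 0 := by
    filter_upwards [h] with t ht
    rw [hPe, hPe, zero_smul, add_zero, Matrix.det_one]
    rw [hfac] at ht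
    have := hA.det_pos
    by_contra hc
    push Not at hc
    nlinarith
  have := hloc.deriv_eq_zero
  rw [Polynomial.deriv, hP] at this
  simpa using this


lemma nesterov_mapsTo (n : ℕ) (hn : 2 ≤ n) (hk : 2 * n - 2 < 2 * n - 1) (c : Fin (2 * n - 1) → ℝ) (hc : (hankel n c).PosDef) :
    0 < hankelStar n (hankel n c)⁻¹ ⟨2 * n - 2, hk⟩ ∧
      ∀ x : ℝ, 0 < ∑ k : Fin (2 * n - 1), hankelStar n (hankel n c)⁻¹ k * x ^ (k : ℕ) := by
  have hI := hc.inv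
  constructor
  · have h1 : hankelStar n (hankel n c)⁻¹ ⟨2 * n - 2, hk⟩ =
        (hankel n c)⁻¹ ⟨n - 1, by omega⟩ ⟨n - 1, by omega⟩ := by
      rw [hankelStar, Finset.sum_eq_single (⟨n - 1, by omega⟩ : Fin n),
        Finset.sum_eq_single (⟨n - 1, by omega⟩ : Fin n)]
      · rw [if_pos]; simp only; omega
      · intro b _ hb
        rw [if_neg]
        intro h
        apply hb
        ext
        simp only at h ⊢
        omega
      · simp
      · intro b _ hb
        refine Finset.sum_eq_zero fun j _ => ?_
        rw [if_neg]
        intro h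
        apply hb
        ext
        have := j.isLt
        have := b.isLt
        simp only at h ⊢
        omega
      · simp
    rw [h1]
    exact hI.diag_pos
  · intro x
    rw [hankelStar_pair n _ (fun k => x ^ k)]
    have hz : (fun i : Fin n => x ^ (i : ℕ)) ≠ 0 := fun h => by
      have := congrFun h ⟨0, by omega⟩
      simp at this
    have := hI.dotProduct_mulVec_pos hz
    simp only [star_trivial, dotProduct, Matrix.mulVec, Finset.mul_sum] at this
    refine this.trans_eq ?_
    refine Finset.sum_congr rfl fun i _ => Finset.sum_congr rfl fun j _ => ?_
    rw [pow_add]; ring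

lemma nesterov_injective (n : ℕ) (hn : 2 ≤ n) (c d : Fin (2 * n - 1) → ℝ)
    (hc : (hankel n c).PosDef) (hd : (hankel n d).PosDef)
    (h : hankelStar n (hankel n c)⁻¹ = hankelStar n (hankel n d)⁻¹) : c = d := by
  have h1 : ((hankel n c)⁻¹ * hankel n (d - c)).trace = ((hankel n d)⁻¹ * hankel n (d - c)).trace := by
    rw [← hankelStar_pair_trace, ← hankelStar_pair_trace, h]
  have hcu : IsUnit (hankel n c).det := hc.det_pos.ne'.isUnit
  have hdu : IsUnit (hankel n d).det := hd.det_pos.ne'.isUnit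
  have h2 : ((hankel n c)⁻¹ * hankel n (d - c) * (hankel n d)⁻¹ * hankel n (d - c)).trace = 0 := by
    have : (hankel n c)⁻¹ * hankel n (d - c) * (hankel n d)⁻¹ = (hankel n c)⁻¹ - (hankel n d)⁻¹ := by
      rw [hankel_sub, mul_sub, sub_mul, Matrix.nonsing_inv_mul _ hcu, one_mul,
        Matrix.mul_nonsing_inv_cancel_right _ _ hdu]
    rw [this, sub_mul, Matrix.trace_sub, h1, sub_self]
  have h3 := trace_inj hc.inv hd.inv (hankel_isHermitian n _) h2
  have h4 := hankel_injective n hn _ h3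
  exact (sub_eq_zero.mp h4).symm

lemma nesterov_surjective (n : ℕ) (hn : 2 ≤ n) (hk : 2 * n - 2 < 2 * n - 1) (p : Fin (2 * n - 1) → ℝ)
    (h0 : 0 < p ⟨2 * n - 2, hk⟩)
    (hp : ∀ x : ℝ, 0 < ∑ k : Fin (2 * n - 1), p k * x ^ (k : ℕ)) :
    ∃ c, (hankel n c).PosDef ∧ hankelStar n (hankel n c)⁻¹ = p := by
  obtain ⟨ε, hε, hεp⟩ := exists_eps n hn hk p h0 hp
  have hcoer := pair_ge n hn p ε hεp
  have hnpos : (0 : ℝ) < n := by exact_mod_cast (by omega : 0 < n)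
  have : Nonempty (Fin n) := ⟨⟨0, by omega⟩⟩
  let pr : (Fin (2 * n - 1) → ℝ) → ℝ := fun c => ∑ k, p k * c k
  have pr_add : ∀ c d, pr (c + d) = pr c + pr d := fun c d => by
    simp [pr, mul_add, Finset.sum_add_distrib]
  have pr_smul : ∀ (t : ℝ) c, pr (t • c) = t * pr c := fun t c => by
    simp only [pr, Finset.mul_sum, Pi.smul_apply, smul_eq_mul]
    exact Finset.sum_congr rfl fun k _ => by ring
  have pr_cont : Continuous pr := by fun_prop
  let K : Set (Fin (2 * n - 1) → ℝ) := {c | (hankel n c).PosSemidef} ∩ {c | pr c = n}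
  have hKclosed : IsClosed K := (isClosed_psd n).inter (isClosed_eq pr_cont continuous_const)
  have hKsub : K ⊆ Metric.closedBall 0 (n / ε) := by
    rintro c ⟨hc, hcn⟩
    have hc : (hankel n c).PosSemidef := hc
    have hcn : pr c = n := hcn
    rw [mem_closedBall_zero_iff, pi_norm_le_iff_of_nonneg (by positivity)]
    intro k
    have ht : (hankel n c).trace ≤ n / ε := by
      rw [le_div_iff₀ hε, mul_comm]
      exact (hcoer c hc).trans_eq hcn
    refine le_trans ?_ ht
    have hk := k.isLt
    by_cases hk2 : (k : ℕ) < n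
    · have := entry_le_trace hc ⟨k, hk2⟩ ⟨0, by omega⟩
      simpa [hankel_apply] using this
    · have := entry_le_trace hc ⟨n - 1, by omega⟩ ⟨k - (n - 1), by omega⟩
      rw [hankel_apply] at this
      have hkk : (⟨n - 1 + ((k : ℕ) - (n - 1)), by omega⟩ : Fin (2 * n - 1)) = k := by
        ext; simp only; omega
      simp only [hkk] at this
      exact this
  have hKc : IsCompact K := (isCompact_closedBall _ _).of_isClosed_subset hKclosed hKsub
  obtain ⟨c₀, hc₀⟩ := exists_posDef n
  have hpr0 : 0 < pr c₀ := (mul_pos hε hc₀.trace_pos).trans_le (hcoer c₀ hc₀.posSemidef)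
  have hs0 : 0 < (n : ℝ) / pr c₀ := div_pos hnpos hpr0
  have hc₁ : (hankel n (((n : ℝ) / pr c₀) • c₀)).PosDef := by
    rw [hankel_smul]; exact hc₀.smul hs0
  have hc₁K : ((n : ℝ) / pr c₀) • c₀ ∈ K := by
    refine ⟨hc₁.posSemidef, ?_⟩
    change pr _ = n
    rw [pr_smul]; field_simp
  obtain ⟨c, hcK, hmax⟩ := hKc.exists_isMaxOn ⟨_, hc₁K⟩
    (f := fun c => (hankel n c).det) ((hankel_continuous n).matrix_det.continuousOn)
  have hcpsd : (hankel n c).PosSemidef := hcK.1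
  have hcn : pr c = n := hcK.2
  have hdet : 0 < (hankel n c).det := hc₁.det_pos.trans_le (hmax hc₁K)
  have hcpd : (hankel n c).PosDef := hcpsd.posDef_iff_det_ne_zero.mpr hdet.ne'
  refine ⟨c, hcpd, ?_⟩
  have hker : ∀ e, pr e = 0 → ((hankel n c)⁻¹ * hankel n e).trace = 0 := by
    intro e he
    apply trace_eq_zero_of_det_le hcpd
    filter_upwards [posDef_perturb hcpd (hankel_isHermitian n e)] with t ht
    have : c + t • e ∈ K := by
      refine ⟨?_, ?_⟩
      · change (hankel n (c + t • e)).PosSemidef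
        rwa [hankel_add, hankel_smul]
      · change pr _ = n
        rw [pr_add, pr_smul, he, mul_zero, add_zero, hcn]
    have h := hmax this
    change (hankel n (c + t • e)).det ≤ (hankel n c).det at h
    rwa [hankel_add, hankel_smul] at h
  have hall : ∀ e, ((hankel n c)⁻¹ * hankel n e).trace = pr e := by
    intro e
    have h1 := hker (e + (-(pr e / n)) • c) (by
      rw [pr_add, pr_smul, hcn]; field_simp; ring)
    rw [hankel_add, hankel_smul, mul_add, Matrix.mul_smul, Matrix.nonsing_inv_mul _ hdet.ne'.isUnit,
      Matrix.trace_add, Matrix.trace_smul, Matrix.trace_one, Fintype.card_fin, smul_eq_mul] at h1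
    have : pr e / n * n = pr e := by field_simp
    linarith
  ext k
  have h1 := hall (Pi.single k 1)
  rw [← hankelStar_pair_trace] at h1
  simpa [pr, Pi.single_apply] using h1

/-- **Bijectivity of the Nesterov map.** The map `N(c) = H*(H(c)⁻¹)` is a bijection
from the interior of the moment cone (vectors `c` with `H(c)` positive definite) onto
the interior of the cone of non-negative polynomials (coefficient vectors `p` with
`p_{2n-2} > 0` whose associated polynomial is positive on `ℝ`). -/
theorem nesterov_map_bijective (n : ℕ) (hn : 2 ≤ n) :
    Set.BijOn (fun c => hankelStar n (hankel n c)⁻¹)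
      {c : Fin (2 * n - 1) → ℝ | (hankel n c).PosDef}
      {p : Fin (2 * n - 1) → ℝ | 0 < p ⟨2 * n - 2, by omega⟩ ∧
        ∀ x : ℝ, 0 < ∑ k : Fin (2 * n - 1), p k * x ^ (k : ℕ)} := by
  refine ⟨fun c hc => nesterov_mapsTo n hn (by omega) c hc, fun c hc d hd h => nesterov_injective n hn c d hc hd h,
    fun p hp => ?_⟩
  obtain ⟨c, hc, h⟩ := nesterov_surjective n hn (by omega) p hp.1 hp.2
  exact ⟨c, hc, h⟩
end

section
/- Let n ≥ 2, let ζ_1, …, ζ_{n-1} ∈ ℍ, let P(x) = ∏_{j=1}^{n-1} (x - ζ_j)(x - conj(ζ_j)), let p_{2n-2} > 0, and set p := p_{2n-2}·P, a polynomial positive on ℝ. Let c ∈ ℝ^{2n-1} be such that H(c) is positive definite and N(c) = p (as coefficient vectors). If x_1 < … < x_n satisfy the equilibrium equations (10) and t_1 < … < t_{n-1} satisfy the equilibrium equations (17), then c_k = ∑_{j=1}^n x_j^k / p(x_j) for all k = 0, …, 2n-2, and also c_k = ∑_{j=1}^{n-1} t_j^k / p(t_j) for k = 0, …, 2n-3 together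 with c_{2n-2} = ∑_{j=1}^{n-1} t_j^{2n-2} / p(t_j) + 1/p_{2n-2}. -/
open Polynomial Finset Complex ComplexConjugate

lemma sum_hankelStar (n : ℕ) (d : Fin (2 * n - 1) → ℝ) (M : Matrix (Fin n) (Fin n) ℝ) :
    (hankel n d * M).trace = ∑ k, d k * hankelStar n M k := by
  simp only [Matrix.trace, Matrix.diag_apply, Matrix.mul_apply, hankelStar, Finset.mul_sum]
  rw [Finset.sum_comm]
  conv_rhs => rw [Finset.sum_comm]
  refine Finset.sum_congr rfl fun i _ => ?_
  rw [Finset.sum_comm]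
  refine Finset.sum_congr rfl fun j _ => ?_
  rw [Finset.sum_eq_single (⟨(i : ℕ) + (j : ℕ), by
    have hi := i.isLt; have hj := j.isLt; omega⟩ : Fin (2 * n - 1))]
  · simp [hankel, add_comm]
  · intro b _ hb
    have : ¬ ((i : ℕ) + (j : ℕ) = (b : ℕ)) := fun h => hb (Fin.ext h.symm)
    simp [this]
  · simp

lemma key_unique {ι : Type*} [Fintype ι] [DecidableEq ι] (n : ℕ) (c c' : Fin (2 * n - 1) → ℝ)
    (hc : (hankel n c).PosDef) (B : Matrix (Fin n) ι ℝ) (w : ι → ℝ) (hw : ∀ i, 0 < w i)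
    (hB : hankel n c' * (B * Matrix.diagonal w * B.transpose) = 1)
    (hN : ∀ k, hankelStar n (hankel n c)⁻¹ k
      = hankelStar n (B * Matrix.diagonal w * B.transpose) k) : c = c' := by
  set H := hankel n c with hH
  set H' := hankel n c' with hH'
  set K := B * Matrix.diagonal w * B.transpose with hK
  have hD : hankel n (c - c') = H - H' := by
    ext i j; simp [hankel, hH, hH']
  set Δ := H - H' with hΔ
  have hKH : K * H' = 1 := mul_eq_one_comm.mp hB
  have hdet : IsUnit H.det := hc.det_pos.ne'.isUnit
  have hHi : H⁻¹ * H = 1 := Matrix.nonsing_inv_mul _ hdet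
  have e1 : (Δ * H⁻¹).trace = (Δ * K).trace := by
    rw [← hD, sum_hankelStar, sum_hankelStar]
    exact Finset.sum_congr rfl fun k _ => by rw [hN k]
  have e2 : H⁻¹ * Δ * K = K - H⁻¹ := by
    rw [hΔ, Matrix.mul_sub, Matrix.sub_mul, hHi, Matrix.one_mul, Matrix.mul_assoc, hB,
      Matrix.mul_one]
  have e3 : (Δ * H⁻¹ * Δ * K).trace = 0 := by
    rw [Matrix.mul_assoc Δ, Matrix.mul_assoc Δ, e2, Matrix.mul_sub, Matrix.trace_sub, e1, sub_self]
  have hsym : Δ.transpose = Δ := by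
    rw [← hD]; ext i j; simp [hankel, Matrix.transpose_apply, add_comm]
  have hHp : (H⁻¹).PosDef := hc.inv
  have e4 : (Δ * H⁻¹ * Δ * K).trace
      = ∑ l, w l * (dotProduct ((Δ * B).col l) (Matrix.mulVec H⁻¹ ((Δ * B).col l))) := by
    have : (Δ * H⁻¹ * Δ * K).trace
        = (Matrix.diagonal w * ((Δ * B).transpose * (H⁻¹ * (Δ * B)))).trace := by
      rw [hK, ← Matrix.mul_assoc, Matrix.trace_mul_comm, ← Matrix.mul_assoc, Matrix.trace_mul_comm,
        Matrix.transpose_mul, hsym]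
      simp only [Matrix.mul_assoc]
      rw [Matrix.trace_mul_comm B]
      simp only [Matrix.mul_assoc]
    rw [this, Matrix.trace]
    refine Finset.sum_congr rfl fun l _ => ?_
    rw [Matrix.diag_apply, Matrix.diagonal_mul]
    rfl
  have e5 : ∀ l, (Δ * B).col l = 0 := by
    intro l
    by_contra hne
    rw [e4] at e3
    have hnn : ∀ l ∈ Finset.univ, 0 ≤ w l * (dotProduct ((Δ * B).col l) (Matrix.mulVec H⁻¹ ((Δ * B).col l))) := by
      intro l _
      have := hHp.posSemidef.dotProduct_mulVec_nonneg ((Δ * B).col l)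
      exact mul_nonneg (hw l).le (by simpa using this)
    have h0 := (Finset.sum_eq_zero_iff_of_nonneg hnn).mp e3 l (Finset.mem_univ _)
    have := hHp.dotProduct_mulVec_pos hne
    have h2 := mul_pos (hw l) this
    simp only [star_trivial] at h2
    linarith
  have e6 : Δ * B = 0 := by
    ext i l; exact congrFun (e5 l) i
  have e7 : Δ = 0 := by
    calc Δ = Δ * (K * H') := by rw [hKH, Matrix.mul_one]
      _ = (Δ * B) * (Matrix.diagonal w * B.transpose * H') := by
        rw [hK]; simp only [Matrix.mul_assoc]
      _ = 0 := by rw [e6, Matrix.zero_mul]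
  funext k
  have hk := k.isLt
  have hk1 : (k : ℕ) / 2 < n := by omega
  have hk2 : (k : ℕ) - (k : ℕ) / 2 < n := by omega
  have := congrFun (congrFun e7 ⟨_, hk1⟩) ⟨_, hk2⟩
  rw [← hD] at this
  simp only [hankel, Matrix.of_apply, Matrix.zero_apply, Pi.sub_apply] at this
  have hkk : (⟨(k : ℕ) / 2 + ((k : ℕ) - (k : ℕ) / 2), by omega⟩ : Fin (2 * n - 1)) = k := by
    apply Fin.ext; simp; omega
  rw [hkk] at this
  linarith

lemma hankelStar_poly {ι : Type*} [Fintype ι] [DecidableEq ι] (n : ℕ) (f : ι → ℝ[X])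
    (hf : ∀ l, (f l).degree < n) (w : ι → ℝ) (k : Fin (2 * n - 1)) :
    hankelStar n ((Matrix.of fun (i : Fin n) l => (f l).coeff i) * Matrix.diagonal w *
      (Matrix.of fun (i : Fin n) l => (f l).coeff i).transpose) k
      = (∑ l, C (w l) * f l ^ 2).coeff k := by
  have hs : ∀ l, f l = ∑ i : Fin n, C ((f l).coeff i) * X ^ (i : ℕ) := by
    intro l
    rw [Fin.sum_univ_eq_sum_range (fun i => C ((f l).coeff i) * X ^ i) n]
    refine ((f l).as_sum_range' n ?_).trans ?_
    rotate_left
    · simp only [C_mul_X_pow_eq_monomial]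
    · by_cases h : f l = 0
      · simp only [h, natDegree_zero]
        have := k.isLt; omega
      · exact (natDegree_lt_iff_degree_lt h).mpr (hf l)
  have h2 : ∀ l, (f l ^ 2).coeff k = ∑ i : Fin n, ∑ j : Fin n,
      if (i : ℕ) + (j : ℕ) = (k : ℕ) then (f l).coeff i * (f l).coeff j else 0 := by
    intro l
    conv_lhs => rw [sq, hs l]
    rw [Finset.sum_mul_sum, finsetSum_coeff]
    refine Finset.sum_congr rfl fun i _ => ?_
    rw [finsetSum_coeff]
    refine Finset.sum_congr rfl fun j _ => ?_
    have : C ((f l).coeff i) * X ^ (i : ℕ) * (C ((f l).coeff j) * X ^ (j : ℕ))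
      = C ((f l).coeff i * (f l).coeff j) * X ^ ((i : ℕ) + (j : ℕ)) := by
      rw [C_mul]; ring
    rw [this, coeff_C_mul_X_pow]
    simp only [eq_comm]
  rw [finsetSum_coeff]
  simp only [coeff_C_mul, h2, hankelStar, Finset.mul_sum]
  rw [Finset.sum_comm]
  conv_rhs => rw [Finset.sum_comm]
  conv_lhs => rw [Finset.sum_comm]
  refine Finset.sum_congr rfl fun i _ => ?_
  conv_rhs => rw [Finset.sum_comm]
  refine Finset.sum_congr rfl fun j _ => ?_
  split_ifs with h
  · rw [Matrix.mul_apply]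
    refine Finset.sum_congr rfl fun l _ => ?_
    rw [Matrix.mul_diagonal]
    simp only [Matrix.of_apply, Matrix.transpose_apply]
    ring
  · simp

lemma key_poly {ι : Type*} [Fintype ι] [DecidableEq ι] (n : ℕ) (hcard : Fintype.card ι = n)
    (c c' : Fin (2 * n - 1) → ℝ)
    (hc : (hankel n c).PosDef) (f : ι → ℝ[X]) (hf : ∀ l, (f l).degree < n)
    (w : ι → ℝ) (hw : ∀ i, 0 < w i) (W : Matrix ι (Fin n) ℝ)
    (hW : ∀ j l, ∑ i : Fin n, W j i * (f l).coeff i = if j = l then 1 else 0)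
    (hH : ∀ a b, hankel n c' a b = ∑ j, W j a * W j b / w j)
    (p : ℝ[X]) (hp : p = ∑ l, C (w l) * f l ^ 2)
    (hN : ∀ k : Fin (2 * n - 1), hankelStar n (hankel n c)⁻¹ k = p.coeff k) : c = c' := by
  set B : Matrix (Fin n) ι ℝ := Matrix.of fun (i : Fin n) l => (f l).coeff i with hBdef
  have hWB : W * B = 1 := by
    ext j l
    rw [Matrix.mul_apply, Matrix.one_apply]
    exact hW j l
  have hBW : B * W = 1 := by
    rw [Matrix.mul_eq_one_comm_of_card_eq]
    · exact hWB
    · simp [hcard]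
  have hH' : hankel n c' = W.transpose * Matrix.diagonal (fun j => (w j)⁻¹) * W := by
    ext a b
    rw [hH, Matrix.mul_apply]
    refine Finset.sum_congr rfl fun j _ => ?_
    rw [Matrix.mul_diagonal, Matrix.transpose_apply, div_eq_mul_inv]
    ring
  have hdd : Matrix.diagonal (fun j => (w j)⁻¹) * Matrix.diagonal w = 1 := by
    rw [Matrix.diagonal_mul_diagonal, ← Matrix.diagonal_one]
    congr 1
    funext j
    exact inv_mul_cancel₀ (hw j).ne'
  refine key_unique n c c' hc B w hw ?_ ?_
  · calc hankel n c' * (B * Matrix.diagonal w * B.transpose)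
        = W.transpose * (Matrix.diagonal (fun j => (w j)⁻¹) * ((W * B) * Matrix.diagonal w))
          * B.transpose := by rw [hH']; simp only [Matrix.mul_assoc]
      _ = 1 := by
        rw [hWB, Matrix.one_mul, hdd, Matrix.mul_one, ← Matrix.transpose_mul, hBW,
          Matrix.transpose_one]
  · intro k
    rw [hN, hp, hankelStar_poly n f hf w k]

lemma eval_deriv_prod {K ι : Type*} [Field K] [DecidableEq ι] (s : Finset ι) (f : ι → K[X]) (v : K)
    (h : ∀ i ∈ s, (f i).eval v ≠ 0) :
    (derivative (∏ i ∈ s, f i)).eval v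
      = (∏ i ∈ s, f i).eval v * ∑ i ∈ s, (derivative (f i)).eval v / (f i).eval v := by
  rw [derivative_prod_finset, eval_finsetSum, Finset.mul_sum]
  refine Finset.sum_congr rfl fun i hi => ?_
  rw [eval_mul, ← Finset.mul_prod_erase s f hi, eval_mul]
  have := h i hi
  field_simp

lemma double_roots {m : ℕ} (v : Fin m → ℝ) (hv : Function.Injective v) (G : ℝ[X])
    (h0 : ∀ k, G.eval (v k) = 0) (h1 : ∀ k, (derivative G).eval (v k) = 0)
    (hd : G.degree < (2 * m : ℕ)) : G = 0 := by
  by_contra hG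
  have hdvd : ∏ k, (X - C (v k)) ^ 2 ∣ G := by
    refine Finset.prod_dvd_of_coprime ?_ ?_
    · intro a _ b _ hab
      exact (isCoprime_X_sub_C_of_isUnit_sub (sub_ne_zero.mpr (hv.ne hab)).isUnit).pow
    · intro k _
      have := (one_lt_rootMultiplicity_iff_isRoot hG).mpr ⟨h0 k, h1 k⟩
      exact (le_rootMultiplicity_iff hG).mp this
  have h2 := degree_le_of_dvd hdvd hG
  rw [degree_prod] at h2
  simp at h2
  have h3 := lt_of_le_of_lt h2 hd
  push_cast at h3
  rw [mul_comm] at h3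
  exact lt_irrefl _ h3

lemma basis_eval {m : ℕ} (v : Fin m → ℝ) (hv : Function.Injective v) (j k : Fin m) :
    (Lagrange.basis univ v j).eval (v k) = if k = j then 1 else 0 := by
  split_ifs with h
  · subst h; exact Lagrange.eval_basis_self hv.injOn (mem_univ _)
  · exact Lagrange.eval_basis_of_ne (Ne.symm h) (mem_univ _)

lemma basis_deriv {m : ℕ} (v : Fin m → ℝ) (hv : Function.Injective v) (k : Fin m) :
    (derivative (Lagrange.basis univ v k)).eval (v k) = ∑ j ∈ univ.erase k, 1 / (v k - v j) := by
  have hself := basis_eval v hv k k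
  have hne : ∀ j ∈ univ.erase k, v k - v j ≠ 0 := fun j hj =>
    sub_ne_zero.mpr (hv.ne (Finset.ne_of_mem_erase hj).symm)
  rw [if_pos rfl] at hself
  unfold Lagrange.basis at hself ⊢
  rw [eval_deriv_prod, hself, one_mul]
  · refine Finset.sum_congr rfl fun j hj => ?_
    have := hne j hj
    simp [Lagrange.basisDivisor, this]
  · intro j hj
    have := hne j hj
    simp [Lagrange.basisDivisor, this]

/-- the interpolation remainder has double zeros -/
lemma remainder {m : ℕ} (v : Fin m → ℝ) (hv : Function.Injective v) (p : ℝ[X])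
    (hp : ∀ k, (derivative p).eval (v k)
      = p.eval (v k) * ∑ j ∈ univ.erase k, 2 / (v k - v j)) (k : Fin m) :
    (p - ∑ l, C (p.eval (v l)) * Lagrange.basis univ v l ^ 2).eval (v k) = 0 ∧
    (derivative (p - ∑ l, C (p.eval (v l)) * Lagrange.basis univ v l ^ 2)).eval (v k) = 0 := by
  constructor
  · rw [eval_sub, eval_finsetSum, Finset.sum_eq_single k]
    · simp [basis_eval v hv]
    · intro b _ hb
      simp [basis_eval v hv, hb.symm]
    · simp
  · rw [derivative_sub, derivative_sum, eval_sub, eval_finsetSum, Finset.sum_eq_single k]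
    · simp only [derivative_C_mul, derivative_pow, eval_mul, eval_C, basis_deriv v hv, eval_pow,
        basis_eval v hv, if_true, hp k]
      simp only [Finset.mul_sum, ← Finset.sum_sub_distrib]
      refine Finset.sum_eq_zero fun j _ => ?_
      simp
      ring
    · intro b _ hb
      simp [derivative_pow, basis_eval v hv, hb.symm]
    · simp

lemma P_facts {m : ℕ} (ζ : Fin m → ℂ) (hζ : ∀ j, 0 < (ζ j).im) (P : ℝ[X])
    (hP : P.map (algebraMap ℝ ℂ) = ∏ j, (X - C (ζ j)) * (X - C (conj (ζ j)))) :
    P.Monic ∧ P.natDegree = 2 * m ∧ (∀ v : ℝ, 0 < P.eval v) ∧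
    ∀ v : ℝ, (((derivative P).eval v : ℝ) : ℂ)
      = (P.eval v : ℝ) * ∑ j, (1 / ((v : ℂ) - ζ j) + 1 / ((v : ℂ) - conj (ζ j))) := by
  have hmon : ∀ j, ((X - C (ζ j)) * (X - C (conj (ζ j)))).Monic := fun j =>
    (monic_X_sub_C _).mul (monic_X_sub_C _)
  have hne : ∀ (v : ℝ) j, (v : ℂ) - ζ j ≠ 0 := by
    intro v j h
    have := congrArg Complex.im h
    simp at this
    exact (hζ j).ne' this
  have hne' : ∀ (v : ℝ) j, (v : ℂ) - conj (ζ j) ≠ 0 := by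
    intro v j h
    have := congrArg Complex.im h
    simp at this
    exact (hζ j).ne' this
  have hev : ∀ (Q : ℝ[X]) (v : ℝ), ((Q.eval v : ℝ) : ℂ) = (Q.map (algebraMap ℝ ℂ)).eval (v : ℂ) := by
    intro Q v
    have := eval_map_algebraMap (B := ℂ) Q (v : ℂ)
    rw [this]
    exact (aeval_algebraMap_apply ℂ v Q).symm
  refine ⟨?_, ?_, ?_, ?_⟩
  · have : (P.map (algebraMap ℝ ℂ)).Monic := by
      rw [hP]; exact monic_prod_of_monic _ _ fun j _ => hmon j
    exact monic_of_injective (algebraMap ℝ ℂ).injective this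
  · rw [← natDegree_map (algebraMap ℝ ℂ), hP, natDegree_prod_of_monic _ _ fun j _ => hmon j]
    have : ∀ j, ((X - C (ζ j)) * (X - C (conj (ζ j)))).natDegree = 2 := by
      intro j
      rw [(monic_X_sub_C _).natDegree_mul (monic_X_sub_C _)]
      simp
    simp [this, mul_comm]
  · intro v
    have h : P.eval v = ∏ j, Complex.normSq ((v : ℂ) - ζ j) := by
      apply Complex.ofReal_injective
      rw [hev, hP, eval_prod]
      push_cast
      refine Finset.prod_congr rfl fun j _ => ?_
      rw [← Complex.mul_conj]
      simp
    rw [h]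
    exact Finset.prod_pos fun j _ => Complex.normSq_pos.mpr (hne v j)
  · intro v
    rw [hev, hev, ← derivative_map, hP, eval_deriv_prod]
    · congr 1
      refine Finset.sum_congr rfl fun j _ => ?_
      have h1 := hne v j
      have h2 := hne' v j
      simp only [derivative_mul, derivative_X_sub_C, one_mul, mul_one, eval_add, eval_mul,
        eval_sub, eval_X, eval_C]
      field_simp
    · intro j _
      simp only [eval_mul, eval_sub, eval_X, eval_C]
      exact mul_ne_zero (hne v j) (hne' v j)

lemma equil_deriv {m m' : ℕ} (ζ : Fin m → ℂ) (hζ : ∀ j, 0 < (ζ j).im) (P : ℝ[X])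
    (hP : P.map (algebraMap ℝ ℂ) = ∏ j, (X - C (ζ j)) * (X - C (conj (ζ j)))) (p2 : ℝ)
    (x : Fin m' → ℝ)
    (hx : ∀ k, (∑ j ∈ Finset.univ.erase k, 2 / ((x k : ℂ) - (x j : ℂ)))
        - ∑ j, (1 / ((x k : ℂ) - ζ j) + 1 / ((x k : ℂ) - conj (ζ j))) = 0) (k : Fin m') :
    (derivative (C p2 * P)).eval (x k)
      = (C p2 * P).eval (x k) * ∑ j ∈ univ.erase k, 2 / (x k - x j) := by
  have h := (P_facts ζ hζ P hP).2.2.2 (x k)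
  rw [← sub_eq_zero.mp (hx k)] at h
  have h' : (derivative P).eval (x k) = P.eval (x k) * ∑ j ∈ univ.erase k, 2 / (x k - x j) := by
    apply Complex.ofReal_injective
    rw [h]; push_cast; rfl
  simp only [derivative_C_mul, eval_mul, eval_C, h']
  ring

lemma basis_degree {m : ℕ} (v : Fin m → ℝ) (hv : Function.Injective v) (l : Fin m) :
    (Lagrange.basis univ v l).natDegree = m - 1 := by
  have := Lagrange.degree_basis hv.injOn (mem_univ l)
  simpa using natDegree_eq_of_degree_eq_some this

lemma sum_basis_natDegree {m : ℕ} (v : Fin m → ℝ) (hv : Function.Injective v) (w : Fin m → ℝ) :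
    (∑ l, C (w l) * Lagrange.basis univ v l ^ 2).natDegree ≤ 2 * (m - 1) := by
  refine natDegree_sum_le_of_forall_le _ _ fun l _ => ?_
  refine (natDegree_C_mul_le _ _).trans ?_
  refine natDegree_pow_le.trans ?_
  rw [basis_degree v hv]

lemma sum_pow_coeff (n : ℕ) (f : ℝ[X]) (hf : f.natDegree < n) (y : ℝ) :
    ∑ i : Fin n, y ^ (i : ℕ) * f.coeff i = f.eval y := by
  rw [eval_eq_sum_range' hf, ← Fin.sum_univ_eq_sum_range (fun i => f.coeff i * y ^ i) n]
  exact Finset.sum_congr rfl fun i _ => mul_comm _ _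

/-- **Theorem 4, direct part.** Let `p = p_{2n-2}·P` be a polynomial positive on `ℝ`
with zeros `ζ_j` and `conj ζ_j`, and let `c` be the moment vector with `N(c) = p`.
If `x_1 < … < x_n` and `t_1 < … < t_{n-1}` satisfy the equilibrium equations (10) and
(17), then the canonical representations hold with weights `1/p(x_j)` (resp. `1/p(t_j)`
and mass `1/p_{2n-2}` at infinity). -/
theorem nesterov_map_canonical_representations
    (n : ℕ) (hn : 2 ≤ n) (ζ : Fin (n - 1) → ℂ) (hζ : ∀ j, 0 < (ζ j).im)
    (P : Polynomial ℝ)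
    (hP : P.map (algebraMap ℝ ℂ) = ∏ j, (X - C (ζ j)) * (X - C (conj (ζ j))))
    (p2 : ℝ) (hp2 : 0 < p2)
    (c : Fin (2 * n - 1) → ℝ) (hc : (hankel n c).PosDef)
    (hN : ∀ k : Fin (2 * n - 1), hankelStar n (hankel n c)⁻¹ k = p2 * P.coeff (k : ℕ))
    (x : Fin n → ℝ) (hx : StrictMono x)
    (hx10 : ∀ k : Fin n,
      (∑ j ∈ Finset.univ.erase k, 2 / ((x k : ℂ) - (x j : ℂ)))
        - ∑ j, (1 / ((x k : ℂ) - ζ j) + 1 / ((x k : ℂ) - conj (ζ j))) = 0)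
    (t : Fin (n - 1) → ℝ) (ht : StrictMono t)
    (ht17 : ∀ k : Fin (n - 1),
      (∑ j ∈ Finset.univ.erase k, 2 / ((t k : ℂ) - (t j : ℂ)))
        - ∑ j, (1 / ((t k : ℂ) - ζ j) + 1 / ((t k : ℂ) - conj (ζ j))) = 0) :
    (∀ k : Fin (2 * n - 1), c k = ∑ j, x j ^ (k : ℕ) / (p2 * P.eval (x j))) ∧
    (∀ k : Fin (2 * n - 1), (k : ℕ) < 2 * n - 2 →
      c k = ∑ j, t j ^ (k : ℕ) / (p2 * P.eval (t j))) ∧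
    c ⟨2 * n - 2, by omega⟩
      = (∑ j, t j ^ (2 * n - 2) / (p2 * P.eval (t j))) + 1 / p2 := by
  classical
  obtain ⟨hmon, hdeg, hpos, -⟩ := P_facts ζ hζ P hP
  have hppos : ∀ v : ℝ, 0 < (C p2 * P).eval v := fun v => by
    rw [eval_mul, eval_C]; exact mul_pos hp2 (hpos v)
  have hpdeg : (C p2 * P).natDegree = 2 * (n - 1) := by
    rw [natDegree_C_mul hp2.ne', hdeg]
  have hplead : (C p2 * P).coeff (2 * (n - 1)) = p2 := by
    rw [coeff_C_mul, ← hdeg, hmon.coeff_natDegree, mul_one]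
  have hN' : ∀ k : Fin (2 * n - 1), hankelStar n (hankel n c)⁻¹ k = (C p2 * P).coeff k := fun k => by
    rw [hN, coeff_C_mul]
  have hn0 : (n : ℕ) ≠ 0 := by omega
  have part1 : c = fun k : Fin (2 * n - 1) => ∑ j, x j ^ (k : ℕ) / (p2 * P.eval (x j)) := by
    have hi := hx.injective
    refine key_poly n (by simp) c _ hc (Lagrange.basis univ x) ?_
      (fun l => (C p2 * P).eval (x l)) (fun l => hppos _) (Matrix.of fun j i => x j ^ (i : ℕ))
      ?_ ?_ (C p2 * P) ?_ hN'
    · intro l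
      rw [degree_lt_iff_coeff_zero]
      intro q hq
      apply coeff_eq_zero_of_natDegree_lt
      rw [basis_degree x hi]; omega
    · intro j l
      simp only [Matrix.of_apply]
      rw [sum_pow_coeff n _ (by rw [basis_degree x hi]; omega), basis_eval x hi]
    · intro a b
      simp only [hankel, Matrix.of_apply, pow_add, eval_mul, eval_C]
    · have hr := remainder x hi (C p2 * P) (equil_deriv ζ hζ P hP p2 x hx10)
      refine sub_eq_zero.mp (double_roots x hi _ (fun k => (hr k).1) (fun k => (hr k).2) ?_)
      rw [degree_lt_iff_coeff_zero]
      intro q hq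
      have h1 := sum_basis_natDegree x hi (fun l => (C p2 * P).eval (x l))
      rw [coeff_sub, coeff_eq_zero_of_natDegree_lt (by omega),
        coeff_eq_zero_of_natDegree_lt (by omega), sub_zero]
  have part2 : c = fun k : Fin (2 * n - 1) => (∑ j, t j ^ (k : ℕ) / (p2 * P.eval (t j)))
      + if (k : ℕ) = 2 * n - 2 then 1 / p2 else 0 := by
    have hi := ht.injective
    set Q : ℝ[X] := ∏ j, (X - C (t j)) with hQ
    have hQm : Q.Monic := monic_prod_of_monic _ _ fun j _ => monic_X_sub_C _
    have hQd : Q.natDegree = n - 1 := by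
      rw [hQ, natDegree_prod_of_monic _ _ fun j _ => monic_X_sub_C _]; simp
    have hQe : ∀ k, Q.eval (t k) = 0 := fun k => by
      rw [hQ, eval_prod]; exact Finset.prod_eq_zero (mem_univ k) (by simp)
    have hl : n - 1 < n := by omega
    have hlast : ∀ f : ℝ[X], ∑ i : Fin n, (if (i : ℕ) = n - 1 then (1 : ℝ) else 0) * f.coeff i
        = f.coeff (n - 1) := by
      intro f
      rw [Finset.sum_eq_single ⟨n - 1, hl⟩]
      · simp
      · intro b _ hb
        have : (b : ℕ) ≠ n - 1 := fun h => hb (Fin.ext h)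
        simp [this]
      · simp
    refine key_poly (ι := Option (Fin (n - 1))) n (by simp; omega) c _ hc
      (fun o => o.elim Q (Lagrange.basis univ t)) ?_
      (fun o => o.elim p2 (fun l => (C p2 * P).eval (t l))) ?_
      (Matrix.of fun o (i : Fin n) => o.elim (if (i : ℕ) = n - 1 then (1 : ℝ) else 0)
        (fun j => t j ^ (i : ℕ)))
      ?_ ?_ (C p2 * P) ?_ hN'
    · intro l
      rw [degree_lt_iff_coeff_zero]
      intro q hq
      apply coeff_eq_zero_of_natDegree_lt
      rcases l with _ | l
      · simp only [Option.elim]; omega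
      · simp only [Option.elim]; rw [basis_degree t hi]; omega
    · rintro (_ | l)
      · exact hp2
      · exact hppos _
    · rintro (_ | j) (_ | l)
      · simp only [Matrix.of_apply, Option.elim, hlast]
        rw [← hQd, hQm.coeff_natDegree]; simp
      · simp only [Matrix.of_apply, Option.elim, hlast]
        have := l.isLt
        rw [coeff_eq_zero_of_natDegree_lt (by rw [basis_degree t hi]; omega)]
        simp
      · simp only [Matrix.of_apply, Option.elim]
        rw [sum_pow_coeff n _ (by omega), hQe]; simp
      · simp only [Matrix.of_apply, Option.elim]
        rw [sum_pow_coeff n _ (by rw [basis_degree t hi]; omega), basis_eval t hi]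
        simp
    · intro a b
      have ha := a.isLt
      have hb := b.isLt
      simp only [hankel, Matrix.of_apply, pow_add, eval_mul, eval_C, Fintype.sum_option,
        Option.elim]
      rw [add_comm]
      congr 1
      by_cases h1 : (a : ℕ) = n - 1 <;> by_cases h2 : (b : ℕ) = n - 1
      · rw [if_pos (by omega)]; simp [h1, h2]
      · rw [if_neg (by omega)]; simp [h2]
      · rw [if_neg (by omega)]; simp [h1]
      · rw [if_neg (by omega)]; simp [h1]
    · have hr := remainder t hi (C p2 * P) (equil_deriv ζ hζ P hP p2 t ht17)
      rw [Fintype.sum_option]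
      simp only [Option.elim]
      have hQ2m : (Q ^ 2).Monic := hQm.pow 2
      have hQ2d : (C p2 * Q ^ 2).natDegree = 2 * (n - 1) := by
        rw [natDegree_C_mul hp2.ne', natDegree_pow, hQd]
      have hQ2l : (C p2 * Q ^ 2).coeff (2 * (n - 1)) = p2 := by
        rw [coeff_C_mul]
        have : 2 * (n - 1) = (Q ^ 2).natDegree := by rw [natDegree_pow, hQd]
        rw [this, hQ2m.coeff_natDegree, mul_one]
      set S := ∑ l, C ((C p2 * P).eval (t l)) * Lagrange.basis univ t l ^ 2 with hS
      have hSd : S.natDegree ≤ 2 * (n - 1 - 1) :=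
        sum_basis_natDegree t hi (fun l => (C p2 * P).eval (t l))
      have hz : (C p2 * P - S) - C p2 * Q ^ 2 = 0 := by
        refine double_roots t hi _ (fun k => ?_) (fun k => ?_) ?_
        · rw [eval_sub, (hr k).1]; simp [hQe]
        · rw [derivative_sub, eval_sub, (hr k).2]; simp [derivative_pow, hQe]
        · rw [degree_lt_iff_coeff_zero]
          intro q hq
          rw [coeff_sub, coeff_sub, coeff_eq_zero_of_natDegree_lt (p := S) (by omega)]
          rcases hq.eq_or_lt with rfl | hq'
          · rw [hplead, hQ2l]; ring
          · rw [coeff_eq_zero_of_natDegree_lt (by omega),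
              coeff_eq_zero_of_natDegree_lt (by omega)]; ring
      linear_combination hz
  refine ⟨fun k => congrFun part1 k, fun k hk => ?_, ?_⟩
  · have := congrFun part2 k
    rw [if_neg hk.ne, add_zero] at this
    exact this
  · have := congrFun part2 ⟨2 * n - 2, by omega⟩
    rw [if_pos rfl] at this
    exact this
end

section
/- Let n ≥ 2, let ζ_1, …, ζ_{n-1} ∈ ℍ, let p_{2n-2} > 0, and set p(x) := p_{2n-2}·∏_{j=1}^{n-1} (x - ζ_j)(x - conj(ζ_j)). Let c ∈ ℝ^{2n-1} be such that H(c) is positive definite and N(c) = p (as coefficient vectors). Suppose t_1 < … < t_{n-1}, σ_1, …, σ_{n-1} > 0 and λ > 0 satisfy c_k = ∑_{j=1}^{n-1} σ_j·t_j^k for k = 0, …, 2n-3 and c_{2n-2} = ∑_{j=1}^{n-1} σ_j·t_j^{2n-2} + λ, and suppose x_1 < … < x_n and ϱ_1, …, ϱ_n > 0 satisfy c_k = ∑_{j=1}^n ϱ_j·x_j^k for all k = 0, …, 2n-2. Then t_1, …, t_{n-1} satisfy the equilibrium equations (17), x_1, …, x_n satisfy the equilibrium equations (10), and moreover σ_k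 = 1/p(t_k) for k = 1, …, n-1, ϱ_k = 1/p(x_k) for k = 1, …, n, and λ = 1/p_{2n-2}. -/
open Polynomial Finset Complex ComplexConjugate

/-- Coefficients of the Nesterov map from an orthogonal family. -/
lemma nesterov_of_orth (n : ℕ) (c : Fin (2 * n - 1) → ℝ) {ι : Type} [Fintype ι] [DecidableEq ι]
    (hcard : Fintype.card ι = n) (q : ι → ℝ[X]) (hq : ∀ i, (q i).degree < n)
    (w : ι → ℝ) (hw : ∀ i, w i ≠ 0)
    (hQ : ∀ i j, ∑ a : Fin n, ∑ b : Fin n,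
      (q i).coeff a * hankel n c a b * (q j).coeff b = if i = j then w i else 0)
    (k : Fin (2 * n - 1)) :
    hankelStar n (hankel n c)⁻¹ k = (∑ i, C (w i)⁻¹ * (q i) ^ 2).coeff k := by
  set H := hankel n c with hH
  let Q : Matrix ι (Fin n) ℝ := Matrix.of fun i a => (q i).coeff a
  have h1 : Q * (H * Q.transpose * Matrix.diagonal (fun i => (w i)⁻¹)) = 1 := by
    have h0 : Q * (H * Q.transpose) = Matrix.diagonal w := by
      ext i j
      rw [Matrix.diagonal_apply, ← hQ i j, Matrix.mul_apply]
      refine Finset.sum_congr rfl fun a _ => ?_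
      rw [Matrix.mul_apply, Finset.mul_sum]
      refine Finset.sum_congr rfl fun b _ => ?_
      simp [Q, mul_assoc]
    rw [← Matrix.mul_assoc, h0, Matrix.diagonal_mul_diagonal, ← Matrix.diagonal_one]
    congr 1
    ext i
    exact mul_inv_cancel₀ (hw i)
  have e : ι ≃ Fin n := Fintype.equivFinOfCardEq hcard
  have h2 : H * (Q.transpose * Matrix.diagonal (fun i => (w i)⁻¹) * Q) = 1 := by
    rw [Matrix.mul_eq_one_comm_of_equiv e] at h1
    simpa [Matrix.mul_assoc] using h1
  rw [Matrix.inv_eq_right_inv h2]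
  have hent : ∀ a b, (Q.transpose * Matrix.diagonal (fun i => (w i)⁻¹) * Q) a b
      = ∑ i, (w i)⁻¹ * ((q i).coeff a * (q i).coeff b) := by
    intro a b
    rw [Matrix.mul_apply]
    refine Finset.sum_congr rfl fun i _ => ?_
    rw [Matrix.mul_diagonal]
    simp [Q]; ring
  have hpoly : ∀ i, q i = ∑ a : Fin n, C ((q i).coeff a) * X ^ (a : ℕ) := by
    intro i
    rw [Fin.sum_univ_eq_sum_range (fun a => C ((q i).coeff a) * (X : ℝ[X]) ^ a)]
    by_cases h : q i = 0
    · simp [h]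
    · exact Polynomial.as_sum_range_C_mul_X_pow' _
        ((Polynomial.natDegree_lt_iff_degree_lt h).2 (hq i))
  have hsq : ∀ i, ((q i) ^ 2).coeff (k : ℕ) = ∑ a : Fin n, ∑ b : Fin n,
      if (a : ℕ) + (b : ℕ) = (k : ℕ) then (q i).coeff a * (q i).coeff b else 0 := by
    intro i
    have : (q i) ^ 2 = ∑ a : Fin n, ∑ b : Fin n,
        C ((q i).coeff a * (q i).coeff b) * X ^ ((a : ℕ) + (b : ℕ)) := by
      conv_lhs => rw [sq, hpoly i, Finset.sum_mul_sum]
      refine Finset.sum_congr rfl fun a _ => Finset.sum_congr rfl fun b _ => ?_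
      rw [C_mul, pow_add]; ring
    rw [this]
    simp only [Polynomial.finsetSum_coeff, Polynomial.coeff_C_mul_X_pow]
    refine Finset.sum_congr rfl fun a _ => Finset.sum_congr rfl fun b _ => ?_
    simp only [eq_comm]
  simp only [hankelStar, hent, Polynomial.finsetSum_coeff, Polynomial.coeff_C_mul, hsq,
    Finset.mul_sum]
  conv_rhs => rw [Finset.sum_comm]
  refine Finset.sum_congr rfl fun a _ => ?_
  conv_rhs => rw [Finset.sum_comm]
  refine Finset.sum_congr rfl fun b _ => ?_
  split_ifs <;> simp

lemma eval_fin_sum (n : ℕ) (q : ℝ[X]) (hq : q.degree < n) (y : ℝ) :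
    q.eval y = ∑ a : Fin n, q.coeff a * y ^ (a : ℕ) := by
  rw [Fin.sum_univ_eq_sum_range (fun a => q.coeff a * y ^ a)]
  by_cases h : q = 0
  · simp [h]
  · exact Polynomial.eval_eq_sum_range' ((Polynomial.natDegree_lt_iff_degree_lt h).2 hq) y

lemma hankel_form (n m : ℕ) (c : Fin (2 * n - 1) → ℝ) (s y : Fin m → ℝ) (lam : ℝ)
    (hH : ∀ a b : Fin n, hankel n c a b = ∑ j, s j * y j ^ ((a : ℕ) + (b : ℕ))
      + lam * ((if (a : ℕ) = n - 1 then 1 else 0) * (if (b : ℕ) = n - 1 then 1 else 0)))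
    (f g : ℝ[X]) (hf : f.degree < n) (hg : g.degree < n) (hn : 0 < n) :
    ∑ a : Fin n, ∑ b : Fin n, f.coeff a * hankel n c a b * g.coeff b
      = ∑ j, s j * (f.eval (y j) * g.eval (y j))
        + lam * (f.coeff (n - 1) * g.coeff (n - 1)) := by
  have hl : ∀ f : ℝ[X], f.coeff (n - 1)
      = ∑ a : Fin n, f.coeff a * (if (a : ℕ) = n - 1 then 1 else 0) := by
    intro f
    rw [Finset.sum_eq_single (⟨n - 1, by omega⟩ : Fin n)]
    · simp
    · intro b _ hb
      have : (b : ℕ) ≠ n - 1 := fun h => hb (Fin.ext h)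
      simp [this]
    · simp
  rw [hl f, hl g]
  simp only [eval_fin_sum n f hf, eval_fin_sum n g hg, hH, mul_add, add_mul,
    Finset.sum_add_distrib, Finset.mul_sum, Finset.sum_mul]
  rw [Finset.sum_comm]
  congr 1
  · conv_rhs => rw [Finset.sum_comm]
    refine Finset.sum_congr rfl fun a _ => ?_
    conv_rhs => rw [Finset.sum_comm]
    refine Finset.sum_congr rfl fun b _ => Finset.sum_congr rfl fun j _ => ?_
    rw [pow_add]; ring
  · rw [Finset.sum_comm]
    refine Finset.sum_congr rfl fun a _ => Finset.sum_congr rfl fun b _ => ?_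
    ring

lemma eval_derivative_prod_log {K ι : Type*} [Field K] [DecidableEq ι] (s : Finset ι) (f : ι → K[X])
    (z : K) (h : ∀ i ∈ s, (f i).eval z ≠ 0) :
    (derivative (∏ i ∈ s, f i)).eval z
      = (∏ i ∈ s, f i).eval z * ∑ i ∈ s, (derivative (f i)).eval z / (f i).eval z := by
  induction s using Finset.induction_on with
  | empty => simp
  | insert a s ha ih =>
    have ha' := h a (by simp)
    rw [Finset.prod_insert ha, Finset.sum_insert ha, derivative_mul, eval_add, eval_mul, eval_mul,
      ih (fun i hi => h i (by simp [hi])), eval_mul]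
    field_simp

lemma equilibrium_aux (m n : ℕ) (ζ : Fin (n - 1) → ℂ) (hζ : ∀ j, 0 < (ζ j).im)
    (P : Polynomial ℝ)
    (hP : P.map (algebraMap ℝ ℂ) = ∏ j, (X - C (ζ j)) * (X - C (conj (ζ j))))
    (p2 μ : ℝ) (hp2 : 0 < p2) (y w : Fin m → ℝ) (hy : Function.Injective y) (hw : ∀ k, 0 < w k)
    (h : C p2 * P = ∑ k, C (w k)⁻¹ * (Lagrange.basis Finset.univ y k) ^ 2
      + C μ * (∏ j, (X - C (y j))) ^ 2) (k : Fin m) :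
    ((∑ j ∈ Finset.univ.erase k, 2 / ((y k : ℂ) - (y j : ℂ)))
        - ∑ j, (1 / ((y k : ℂ) - ζ j) + 1 / ((y k : ℂ) - conj (ζ j))) = 0) ∧
    w k = 1 / (p2 * P.eval (y k)) := by
  have hinj : Set.InjOn y (Finset.univ : Finset (Fin m)) := hy.injOn
  have hself : ∀ k, (Lagrange.basis Finset.univ y k).eval (y k) = 1 := fun k =>
    Lagrange.eval_basis_self hinj (Finset.mem_univ k)
  have hne : ∀ i, i ≠ k → (Lagrange.basis Finset.univ y i).eval (y k) = 0 := fun i hi =>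
    Lagrange.eval_basis_of_ne hi (Finset.mem_univ k)
  have hω : (∏ j, (X - C (y j))).eval (y k) = 0 := by
    rw [eval_prod]
    exact Finset.prod_eq_zero (Finset.mem_univ k) (by simp)
  have hval : p2 * P.eval (y k) = (w k)⁻¹ := by
    have := congrArg (Polynomial.eval (y k)) h
    simp only [eval_mul, eval_C, eval_add, eval_finsetSum, eval_pow, hω] at this
    rw [this, Finset.sum_eq_single k]
    · simp [hself]
    · intro b _ hb; simp [hne b hb]
    · simp
  have hder : p2 * (derivative P).eval (y k)
      = (w k)⁻¹ * (2 * (derivative (Lagrange.basis Finset.univ y k)).eval (y k)) := by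
    have := congrArg (fun q => Polynomial.eval (y k) (derivative q)) h
    simp only [derivative_C_mul, derivative_add, derivative_sum, derivative_sq, eval_mul, eval_C,
      eval_add, eval_finsetSum, hω] at this
    rw [this, Finset.sum_eq_single k]
    · simp [hself]
    · intro b _ hb; simp [hne b hb]
    · simp
  refine ⟨?_, by rw [hval]; simp⟩
  have hL : (derivative (Lagrange.basis Finset.univ y k)).eval (y k)
      = ∑ j ∈ Finset.univ.erase k, 1 / (y k - y j) := by
    have hk := hself k
    rw [Lagrange.basis] at hk ⊢
    have hjk : ∀ j ∈ Finset.univ.erase k, y k - y j ≠ 0 := fun j hj =>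
      sub_ne_zero.2 fun e => (Finset.mem_erase.1 hj).1 (hy e).symm
    have hb : ∀ j ∈ Finset.univ.erase k, (Lagrange.basisDivisor (y k) (y j)).eval (y k) = 1 :=
      fun j hj => Lagrange.eval_basisDivisor_left_of_ne (sub_ne_zero.1 (hjk j hj))
    rw [eval_derivative_prod_log _ _ _ (fun j hj => by rw [hb j hj]; exact one_ne_zero), hk, one_mul]
    refine Finset.sum_congr rfl fun j hj => ?_
    rw [hb j hj]
    simp [Lagrange.basisDivisor]
  have hPd : (derivative P).eval (y k)
      = P.eval (y k) * (2 * ∑ j ∈ Finset.univ.erase k, 1 / (y k - y j)) := by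
    have : p2 * ((derivative P).eval (y k))
        = p2 * (P.eval (y k) * (2 * ∑ j ∈ Finset.univ.erase k, 1 / (y k - y j))) := by
      rw [hder, hL, ← mul_assoc p2, hval]
    exact mul_left_cancel₀ hp2.ne' this
  have hP0 : P.eval (y k) ≠ 0 := by
    intro h0
    rw [h0, mul_zero] at hval
    exact (inv_pos.2 (hw k)).ne hval
  have hz1 : ∀ j, (y k : ℂ) - ζ j ≠ 0 := fun j e => by
    have := congrArg Complex.im e
    simp at this
    exact (hζ j).ne' this
  have hz2 : ∀ j, (y k : ℂ) - conj (ζ j) ≠ 0 := fun j e => by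
    have := congrArg Complex.im e
    simp at this
    exact (hζ j).ne' this
  have hC := eval_derivative_prod_log Finset.univ
    (fun j => (X - C (ζ j)) * (X - C (conj (ζ j)))) (y k : ℂ)
    (fun j _ => by simpa using ⟨hz1 j, hz2 j⟩)
  rw [← hP, derivative_map] at hC
  have he : ∀ q : ℝ[X], (q.map (algebraMap ℝ ℂ)).eval (y k : ℂ) = ((q.eval (y k) : ℝ) : ℂ) :=
    fun q => by
      have := Polynomial.eval_map_apply (f := algebraMap ℝ ℂ) (p := q) (y k)
      simpa using this
  rw [he, he, hPd, Complex.ofReal_mul] at hC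
  have hC' := mul_left_cancel₀ (Complex.ofReal_ne_zero.2 hP0) hC
  rw [sub_eq_zero]
  calc _ = ((2 * ∑ j ∈ Finset.univ.erase k, 1 / (y k - y j) : ℝ) : ℂ) := by
        push_cast
        rw [Finset.mul_sum]
        refine Finset.sum_congr rfl fun j _ => ?_
        ring
    _ = _ := by
        rw [hC']
        refine Finset.sum_congr rfl fun j _ => ?_
        have := hz1 j
        have := hz2 j
        simp
        field_simp

/-- **Theorem 4, converse part (Lemma on the converse).** Let `p = p_{2n-2}·P` be a
polynomial positive on `ℝ` with zeros `ζ_j, conj ζ_j`, and let `c` be a moment vector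
with `H(c)` positive definite and `N(c) = p`. If `t_1 < … < t_{n-1}`, `σ_j > 0`,
`λ > 0` and `x_1 < … < x_n`, `ϱ_j > 0` give the two canonical representations of `c`,
then the equilibrium equations (17) and (10) hold, and moreover `σ_k = 1/p(t_k)`,
`ϱ_k = 1/p(x_k)`, `λ = 1/p_{2n-2}`. -/
theorem canonical_representations_give_equilibrium
    (n : ℕ) (hn : 2 ≤ n) (ζ : Fin (n - 1) → ℂ) (hζ : ∀ j, 0 < (ζ j).im)
    (P : Polynomial ℝ)
    (hP : P.map (algebraMap ℝ ℂ) = ∏ j, (X - C (ζ j)) * (X - C (conj (ζ j))))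
    (p2 : ℝ) (hp2 : 0 < p2)
    (c : Fin (2 * n - 1) → ℝ) (hc : (hankel n c).PosDef)
    (hN : ∀ k : Fin (2 * n - 1), hankelStar n (hankel n c)⁻¹ k = p2 * P.coeff (k : ℕ))
    (t σ : Fin (n - 1) → ℝ) (lam : ℝ)
    (ht : StrictMono t) (hσ : ∀ j, 0 < σ j) (hlam : 0 < lam)
    (hrep : ∀ k : Fin (2 * n - 1), (k : ℕ) < 2 * n - 2 →
      c k = ∑ j, σ j * t j ^ (k : ℕ))
    (hrep' : c ⟨2 * n - 2, by omega⟩ = (∑ j, σ j * t j ^ (2 * n - 2)) + lam)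
    (x ρ : Fin n → ℝ) (hx : StrictMono x) (hρ : ∀ k, 0 < ρ k)
    (hrepx : ∀ k : Fin (2 * n - 1), c k = ∑ j, ρ j * x j ^ (k : ℕ)) :
    (∀ k : Fin (n - 1),
      (∑ j ∈ Finset.univ.erase k, 2 / ((t k : ℂ) - (t j : ℂ)))
        - ∑ j, (1 / ((t k : ℂ) - ζ j) + 1 / ((t k : ℂ) - conj (ζ j))) = 0) ∧
    (∀ k : Fin n,
      (∑ j ∈ Finset.univ.erase k, 2 / ((x k : ℂ) - (x j : ℂ)))
        - ∑ j, (1 / ((x k : ℂ) - ζ j) + 1 / ((x k : ℂ) - conj (ζ j))) = 0) ∧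
    (∀ k, σ k = 1 / (p2 * P.eval (t k))) ∧
    (∀ k, ρ k = 1 / (p2 * P.eval (x k))) ∧
    lam = 1 / p2 := by
  have hmon : ∀ j, ((X - C (ζ j)) * (X - C (conj (ζ j)))).Monic := fun j =>
    (monic_X_sub_C _).mul (monic_X_sub_C _)
  have hPm : P.Monic := by
    have : (P.map (algebraMap ℝ ℂ)).Monic := by
      rw [hP]; exact monic_prod_of_monic _ _ fun j _ => hmon j
    exact (Polynomial.monic_map_iff).1 this
  have hPdeg : P.natDegree = 2 * n - 2 := by
    rw [← Polynomial.natDegree_map (algebraMap ℝ ℂ) (p := P), hP,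
      natDegree_prod_of_monic _ _ fun j _ => hmon j]
    have : ∀ j, ((X - C (ζ j)) * (X - C (conj (ζ j)))).natDegree = 2 := fun j => by
      rw [(monic_X_sub_C _).natDegree_mul (monic_X_sub_C _)]; simp
    simp only [this]
    simp
    omega
  have hPlead : P.coeff (2 * n - 2) = 1 := by rw [← hPdeg]; exact hPm
  -- extension of the coefficient identity to a polynomial identity
  have hext : ∀ R : ℝ[X], R.degree < ((2 * n - 1 : ℕ) : WithBot ℕ) →
      (∀ k : Fin (2 * n - 1), hankelStar n (hankel n c)⁻¹ k = R.coeff k) → C p2 * P = R := by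
    intro R hR h
    ext k
    rw [coeff_C_mul]
    by_cases hk : k < 2 * n - 1
    · rw [← h ⟨k, hk⟩, hN]
    · rw [coeff_eq_zero_of_natDegree_lt (by omega : P.natDegree < k),
        coeff_eq_zero_of_degree_lt (lt_of_lt_of_le hR (by exact_mod_cast not_lt.1 hk)), mul_zero]
  have hsqdeg : ∀ (a : ℝ) (q : ℝ[X]), q.degree < n →
      (C a * q ^ 2).degree < ((2 * n - 1 : ℕ) : WithBot ℕ) := by
    intro a q hq
    have h1 : q.natDegree ≤ n - 1 := by
      rw [natDegree_le_iff_degree_le]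
      rcases eq_or_ne q 0 with h | h
      · simp [h]
      · rw [degree_eq_natDegree h] at hq ⊢
        have : q.natDegree < n := by exact_mod_cast hq
        exact_mod_cast (by omega : q.natDegree ≤ n - 1)
    have h2 : (C a * q ^ 2).natDegree ≤ 2 * (n - 1) :=
      (natDegree_C_mul_le _ _).trans ((natDegree_pow_le).trans (by omega))
    refine lt_of_le_of_lt (natDegree_le_iff_degree_le.1 h2) ?_
    exact_mod_cast (by omega : 2 * (n - 1) < 2 * n - 1)
  have hsumdeg : ∀ {ι : Type} [Fintype ι] (a : ι → ℝ) (q : ι → ℝ[X]), (∀ i, (q i).degree < n) →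
      (∑ i, C (a i) * (q i) ^ 2).degree < ((2 * n - 1 : ℕ) : WithBot ℕ) := by
    intro ι _ a q hq
    refine lt_of_le_of_lt (degree_sum_le _ _) ?_
    rw [Finset.sup_lt_iff (WithBot.bot_lt_coe _)]
    exact fun i _ => hsqdeg _ _ (hq i)
  -- the nodes `x`
  have hxpoly : C p2 * P = ∑ k, C (ρ k)⁻¹ * (Lagrange.basis Finset.univ x k) ^ 2 := by
    have hdeg : ∀ k, (Lagrange.basis Finset.univ x k).degree < n := fun k => by
      rw [Lagrange.degree_basis hx.injective.injOn (Finset.mem_univ k)]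
      simp only [Finset.card_univ, Fintype.card_fin]
      exact_mod_cast (by omega : n - 1 < n)
    refine hext _ (hsumdeg _ _ hdeg) fun k => ?_
    refine nesterov_of_orth n c (Fintype.card_fin n) _ hdeg ρ (fun i => (hρ i).ne') ?_ k
    intro i j
    rw [hankel_form n n c ρ x 0 (fun a b => by simp [hankel, hrepx]) _ _ (hdeg i) (hdeg j)
      (by omega)]
    rw [Finset.sum_eq_single i]
    · rw [Lagrange.eval_basis_self hx.injective.injOn (Finset.mem_univ i)]
      split_ifs with hij
      · subst hij
        rw [Lagrange.eval_basis_self hx.injective.injOn (Finset.mem_univ i)]; simp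
      · rw [Lagrange.eval_basis_of_ne (Ne.symm hij) (Finset.mem_univ i)]; simp
    · intro b _ hb
      rw [Lagrange.eval_basis_of_ne (Ne.symm hb) (Finset.mem_univ b)]; simp
    · simp
  -- the nodes `t`
  have hωm : (∏ j, (X - C (t j))).Monic := monic_prod_of_monic _ _ fun j _ => monic_X_sub_C _
  have hωd : (∏ j, (X - C (t j))).natDegree = n - 1 := by
    rw [natDegree_prod_of_monic _ _ fun j _ => monic_X_sub_C _]; simp
  have hωc : (∏ j, (X - C (t j))).coeff (n - 1) = 1 := by
    have h := hωm
    rwa [Monic, leadingCoeff, hωd] at h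
  have hω0 : ∀ k, (∏ j, (X - C (t j))).eval (t k) = 0 := fun k => by
    rw [eval_prod]
    exact Finset.prod_eq_zero (Finset.mem_univ k) (by simp)
  have hbd : ∀ k, (Lagrange.basis Finset.univ t k).degree < ((n - 1 : ℕ) : WithBot ℕ) := fun k => by
    rw [Lagrange.degree_basis ht.injective.injOn (Finset.mem_univ k)]
    simp only [Finset.card_univ, Fintype.card_fin]
    exact_mod_cast (by omega : n - 1 - 1 < n - 1)
  have hbc : ∀ k, (Lagrange.basis Finset.univ t k).coeff (n - 1) = 0 := fun k =>
    coeff_eq_zero_of_degree_lt (hbd k)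
  have htpoly : C p2 * P = ∑ k, C (σ k)⁻¹ * (Lagrange.basis Finset.univ t k) ^ 2
      + C lam⁻¹ * (∏ j, (X - C (t j))) ^ 2 := by
    let q : Option (Fin (n - 1)) → ℝ[X] := fun o =>
      o.elim (∏ j, (X - C (t j))) (fun k => Lagrange.basis Finset.univ t k)
    let w : Option (Fin (n - 1)) → ℝ := fun o => o.elim lam σ
    have hq : ∀ o, (q o).degree < n := by
      rintro (_ | k)
      · change (∏ j, (X - C (t j))).degree < (n : WithBot ℕ)
        rw [degree_eq_natDegree hωm.ne_zero, hωd]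
        exact_mod_cast (by omega : n - 1 < n)
      · exact (hbd k).trans (by exact_mod_cast (by omega : n - 1 < n))
    have hw : ∀ o, w o ≠ 0 := by
      rintro (_ | k)
      · exact hlam.ne'
      · exact (hσ k).ne'
    have hmain : C p2 * P = ∑ o, C (w o)⁻¹ * (q o) ^ 2 := by
      refine hext _ (hsumdeg _ _ hq) fun k => ?_
      refine nesterov_of_orth n c (by simp; omega) _ hq w hw ?_ k
      intro i j
      have hH : ∀ a b : Fin n, hankel n c a b = ∑ j, σ j * t j ^ ((a : ℕ) + (b : ℕ))
          + lam * ((if (a : ℕ) = n - 1 then 1 else 0) * (if (b : ℕ) = n - 1 then 1 else 0)) := by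
        intro a b
        have := a.isLt
        have := b.isLt
        by_cases hab : (a : ℕ) + (b : ℕ) < 2 * n - 2
        · have h0 : ¬ ((a : ℕ) = n - 1 ∧ (b : ℕ) = n - 1) := by omega
          rw [hankel, Matrix.of_apply, hrep _ hab]
          split_ifs with h1 h2 <;> simp_all
        · have h1 : (a : ℕ) = n - 1 := by omega
          have h2 : (b : ℕ) = n - 1 := by omega
          have h3 : (⟨(a : ℕ) + (b : ℕ), by omega⟩ : Fin (2 * n - 1)) = ⟨2 * n - 2, by omega⟩ :=
            Fin.ext (by simp; omega)
          rw [hankel, Matrix.of_apply, h3, hrep', if_pos h1, if_pos h2,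
            (by omega : (a : ℕ) + (b : ℕ) = 2 * n - 2)]
          simp
      rw [hankel_form n (n - 1) c σ t lam hH _ _ (hq i) (hq j) (by omega)]
      rcases i with _ | i <;> rcases j with _ | j
      · simp [q, w, hω0, hωc]
      · simp [q, w, hω0, hωc, hbc]
      · simp [q, w, hω0, hωc, hbc]
      · simp only [q, w, Option.elim, hbc, Option.some.injEq]
        rw [Finset.sum_eq_single i]
        · rw [Lagrange.eval_basis_self ht.injective.injOn (Finset.mem_univ i)]
          split_ifs with hij
          · subst hij
            rw [Lagrange.eval_basis_self ht.injective.injOn (Finset.mem_univ i)]; simp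
          · rw [Lagrange.eval_basis_of_ne (Ne.symm hij) (Finset.mem_univ i)]; simp
        · intro b _ hb
          rw [Lagrange.eval_basis_of_ne (Ne.symm hb) (Finset.mem_univ b)]; simp
        · simp
    rw [hmain, Fintype.sum_option, add_comm]
    rfl
  have Ht := equilibrium_aux (n - 1) n ζ hζ P hP p2 lam⁻¹ hp2 t σ ht.injective hσ htpoly
  have Hx := equilibrium_aux n n ζ hζ P hP p2 0 hp2 x ρ hx.injective hρ (by simpa using hxpoly)
  refine ⟨fun k => (Ht k).1, fun k => (Hx k).1, fun k => (Ht k).2, fun k => (Hx k).2, ?_⟩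
  have hlead := congrArg (fun q => coeff q (2 * n - 2)) htpoly
  have hω2 : ((∏ j, (X - C (t j))) ^ 2).coeff (2 * n - 2) = 1 := by
    have h := hωm.pow 2
    rw [Monic, leadingCoeff, hωm.natDegree_pow, hωd] at h
    rwa [(by omega : 2 * n - 2 = 2 * (n - 1))]
  have hb2 : ∀ k, ((Lagrange.basis Finset.univ t k) ^ 2).coeff (2 * n - 2) = 0 := by
    intro k
    refine coeff_eq_zero_of_natDegree_lt ?_
    have h1 : (Lagrange.basis Finset.univ t k).natDegree < n - 1 :=
      (natDegree_lt_iff_degree_lt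
        (Lagrange.basis_ne_zero ht.injective.injOn (Finset.mem_univ k))).2 (hbd k)
    exact lt_of_le_of_lt natDegree_pow_le (by omega)
  simp only [coeff_C_mul, coeff_add, finsetSum_coeff, hω2, hb2, hPlead] at hlead
  simp at hlead
  rw [hlead]; simp
end
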